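/- arXiv:1902.11215 — 7 statements merged into one kernel-verified Lean document; each statement's English description precedes it below -/
import Mathlib

section
/- Let ρ : ℕ₊ → (0,∞) be a positive completely multiplicative function on the positive integers, and let k : ℕ₊ → ℂ with Σ_{n=1}^∞ |k(n)| ρ(n) < ∞. Then for every completely multiplicative function ψ : ℕ₊ → ℂ with |ψ(n)| ≤ ρ(n) for all n, and every ε > 0, there exists s ∈ ℂ with Re s ≥ 0 such that |Σ_{n=1}^∞ k(n)·conj(ψ(n)) − Σ_{n=1}^∞ k(n) ρ(n) n^{−s}| < ε. In other words, Σ_{n=1}^∞ k(n) conj(ψ(n)) lies in the closure of the set {Σ_{n=1}^∞ k(n) ρ(n) n^{−s} : s ∈ ℂ, Re s ≥ 0}. -/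
open MonoidAlgebra Filter Topology

/-- The monoid homomorphism `n ↦ n ^ (-s)`. -/
noncomputable def cpowHom (s : ℂ) : ℕ+ →* ℂ where
  toFun n := ((n : ℕ) : ℂ) ^ (-s)
  map_one' := by simp
  map_mul' m n := by
    rw [PNat.mul_coe, Nat.cast_mul, Complex.natCast_mul_natCast_cpow]

/-- Evaluation at `s` of the Dirichlet polynomial encoded by an element of `ℂ[ℕ+]`. -/
noncomputable def dirichletEval (s : ℂ) : MonoidAlgebra ℂ ℕ+ →ₐ[ℂ] ℂ :=
  MonoidAlgebra.lift ℂ ℂ ℕ+ (cpowHom s)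

/-- The translation `n ↦ n ^ (-s) • n` of Dirichlet polynomials. -/
noncomputable def dirichletShift (s : ℂ) : MonoidAlgebra ℂ ℕ+ →ₐ[ℂ] MonoidAlgebra ℂ ℕ+ :=
  MonoidAlgebra.lift ℂ (MonoidAlgebra ℂ ℕ+) ℕ+
    { toFun n := single n (cpowHom s n)
      map_one' := by rw [map_one]; rfl
      map_mul' m n := by rw [map_mul, single_mul_single] }

lemma cpowHom_add (s w : ℂ) (n : ℕ+) : cpowHom (s + w) n = cpowHom s n * cpowHom w n := by
  have hn : ((n : ℕ) : ℂ) ≠ 0 := by exact_mod_cast n.ne_zero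
  change ((n : ℕ) : ℂ) ^ (-(s + w)) = ((n : ℕ) : ℂ) ^ (-s) * ((n : ℕ) : ℂ) ^ (-w)
  rw [neg_add, Complex.cpow_add _ _ hn]

lemma cpowHom_eq_exp (s : ℂ) (n : ℕ+) :
    cpowHom s n = Complex.exp (-s * (Real.log (n : ℕ) : ℝ)) := by
  have hn : ((n : ℕ) : ℂ) ≠ 0 := by exact_mod_cast n.ne_zero
  change ((n : ℕ) : ℂ) ^ (-s) = _
  rw [Complex.cpow_def_of_ne_zero hn, Complex.natCast_log, mul_comm]

lemma norm_cpowHom (s : ℂ) (n : ℕ+) :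
    ‖cpowHom s n‖ = Real.exp (-s.re * Real.log (n : ℕ)) := by
  rw [cpowHom_eq_exp, Complex.norm_exp, Complex.re_mul_ofReal, Complex.neg_re]

lemma norm_cpowHom_le_one {s : ℂ} (hs : 0 ≤ s.re) (n : ℕ+) : ‖cpowHom s n‖ ≤ 1 := by
  rw [norm_cpowHom, Real.exp_le_one_iff]
  have := Real.log_natCast_nonneg (n : ℕ)
  nlinarith

lemma dirichletEval_single (s : ℂ) (n : ℕ+) (c : ℂ) :
    dirichletEval s (single n c) = c * cpowHom s n := by
  simp [dirichletEval]

lemma dirichletEval_shift (s w : ℂ) (P : MonoidAlgebra ℂ ℕ+) :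
    dirichletEval w (dirichletShift s P) = dirichletEval (s + w) P := by
  induction P using MonoidAlgebra.induction_linear with
  | zero => simp
  | add P Q hP hQ => simp [hP, hQ]
  | single n c => simp [dirichletShift, dirichletEval_single, cpowHom_add, mul_assoc]

/-- The constant term of an exponential sum is bounded by its supremum. -/
lemma norm_const_le_of_exp_sum_le {ι : Type*} (θ : ι → ℝ) (s : Finset ι)
    (hθ : ∀ i ∈ s, θ i ≠ 0) (c₀ : ℂ) (M : ℝ) (c : ι → ℂ)
    (h : ∀ t : ℝ, ‖c₀ + ∑ i ∈ s, c i * Complex.exp ((θ i * t : ℝ) * Complex.I)‖ ≤ M) :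
    ‖c₀‖ ≤ M := by
  classical
  induction s using Finset.induction_on generalizing c with
  | empty => simpa using h 0
  | insert j s hj ih =>
    have hθj : θ j ≠ 0 := hθ j (Finset.mem_insert_self _ _)
    set τ : ℝ := Real.pi / θ j with hτ
    refine ih (fun i hi => hθ i (Finset.mem_insert_of_mem hi))
      (fun i => c i * (1 + Complex.exp ((θ i * τ : ℝ) * Complex.I)) / 2) fun t => ?_
    have h1 := h t
    have h2 := h (t + τ)
    have hexp (i : ι) : Complex.exp ((θ i * (t + τ) : ℝ) * Complex.I) =
        Complex.exp ((θ i * t : ℝ) * Complex.I) * Complex.exp ((θ i * τ : ℝ) * Complex.I) := by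
      rw [← Complex.exp_add]; push_cast; ring_nf
    have hjexp : Complex.exp ((θ j * τ : ℝ) * Complex.I) = -1 := by
      rw [hτ, mul_div_cancel₀ _ hθj, Complex.exp_pi_mul_I]
    rw [Finset.sum_insert hj] at h1 h2
    have key : c₀ + ∑ i ∈ s, c i * (1 + Complex.exp ((θ i * τ : ℝ) * Complex.I)) / 2 *
          Complex.exp ((θ i * t : ℝ) * Complex.I) =
        ((c₀ + (c j * Complex.exp ((θ j * t : ℝ) * Complex.I) +
          ∑ i ∈ s, c i * Complex.exp ((θ i * t : ℝ) * Complex.I))) +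
        (c₀ + (c j * Complex.exp ((θ j * (t + τ) : ℝ) * Complex.I) +
          ∑ i ∈ s, c i * Complex.exp ((θ i * (t + τ) : ℝ) * Complex.I)))) / 2 := by
      have hsum : ∑ i ∈ s, c i * (1 + Complex.exp ((θ i * τ : ℝ) * Complex.I)) / 2 *
          Complex.exp ((θ i * t : ℝ) * Complex.I) =
          (∑ i ∈ s, c i * Complex.exp ((θ i * t : ℝ) * Complex.I) +
          ∑ i ∈ s, c i * Complex.exp ((θ i * (t + τ) : ℝ) * Complex.I)) / 2 := by
        rw [← Finset.sum_add_distrib, Finset.sum_div]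
        refine Finset.sum_congr rfl fun i _ => ?_
        rw [hexp]; ring
      rw [hsum, hexp, hjexp]; ring
    rw [key, norm_div, Complex.norm_ofNat, div_le_iff₀ two_pos]
    exact (norm_add_le _ _).trans (by linarith)

/-- The coefficients of a Dirichlet polynomial are bounded by its supremum on the imaginary
axis. -/
lemma norm_coeff_le_of_dirichletEval_le (P : MonoidAlgebra ℂ ℕ+) (M : ℝ)
    (h : ∀ t : ℝ, ‖dirichletEval (t * Complex.I) P‖ ≤ M) (n : ℕ+) : ‖P.coeff n‖ ≤ M := by
  classical
  have hlog (m : ℕ+) : 0 < ((m : ℕ) : ℝ) := by exact_mod_cast m.pos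
  refine norm_const_le_of_exp_sum_le
    (fun m : ℕ+ => Real.log (n : ℕ) - Real.log (m : ℕ)) (P.coeff.support.erase n) ?_ _ M P.coeff
    fun t => ?_
  · intro m hm h0
    have := Real.log_injOn_pos (hlog n) (hlog m) (sub_eq_zero.mp h0)
    exact (Finset.ne_of_mem_erase hm) (PNat.coe_injective (by exact_mod_cast this.symm))
  · have hu : ‖cpowHom (-(t * Complex.I)) n‖ = 1 := by rw [norm_cpowHom]; simp
    have hterm (m : ℕ+) : Complex.exp
        (((Real.log (n : ℕ) - Real.log (m : ℕ)) * t : ℝ) * Complex.I) =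
        cpowHom (t * Complex.I) m * cpowHom (-(t * Complex.I)) n := by
      rw [cpowHom_eq_exp, cpowHom_eq_exp, ← Complex.exp_add]
      push_cast; ring_nf
    have heq : P.coeff n + ∑ m ∈ P.coeff.support.erase n, P.coeff m * Complex.exp
        (((Real.log (n : ℕ) - Real.log (m : ℕ)) * t : ℝ) * Complex.I) =
        dirichletEval (t * Complex.I) P * cpowHom (-(t * Complex.I)) n := by
      have hn : P.coeff n = P.coeff n * Complex.exp
          (((Real.log (n : ℕ) - Real.log (n : ℕ)) * t : ℝ) * Complex.I) := by simp
      rw [dirichletEval, MonoidAlgebra.lift_apply', Finsupp.sum, Finset.sum_mul]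
      conv_lhs => rw [hn]
      by_cases hs : n ∈ P.coeff.support
      · rw [Finset.add_sum_erase _ (fun m => P.coeff m * Complex.exp
          (((Real.log (n : ℕ) - Real.log (m : ℕ)) * t : ℝ) * Complex.I)) hs]
        refine Finset.sum_congr rfl fun m _ => ?_
        rw [hterm, Algebra.algebraMap_self, RingHom.id_apply, mul_assoc]
      · rw [Finset.erase_eq_of_notMem hs, Finsupp.notMem_support_iff.mp hs, zero_mul, zero_add]
        refine Finset.sum_congr rfl fun m _ => ?_
        rw [hterm, Algebra.algebraMap_self, RingHom.id_apply, mul_assoc]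
    rw [heq, norm_mul, hu, mul_one]
    exact h t

/-- The support of a power in a commutative monoid algebra grows at most polynomially. -/
lemma card_support_coeff_pow_le {R M : Type*} [CommSemiring R] [CommMonoid M]
    (P : MonoidAlgebra R M) (k : ℕ) :
    (P ^ k).coeff.support.card ≤ (k + 1) ^ P.coeff.support.card := by
  classical
  set S := P.coeff.support
  let B (k : ℕ) : Finset M := (Fintype.piFinset fun _ : S => Finset.range (k + 1)).image
    fun f => ∏ m : S, (m : M) ^ f m
  have hsub (k : ℕ) : (P ^ k).coeff.support ⊆ B k := by
    induction k with
    | zero =>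
      rw [pow_zero]
      refine support_coeff_one_subset.trans fun x hx => ?_
      rw [Finset.mem_one] at hx
      refine Finset.mem_image.mpr ⟨fun _ => 0, ?_, ?_⟩ <;> simp [hx]
    | succ k ih =>
      rw [pow_succ]
      refine (support_coeff_mul_subset _ _).trans fun x hx => ?_
      obtain ⟨y, hy, z, hz, rfl⟩ := Finset.mem_mul.mp hx
      obtain ⟨f, hf, rfl⟩ := Finset.mem_image.mp (ih hy)
      rw [Fintype.mem_piFinset] at hf
      refine Finset.mem_image.mpr ⟨f + Pi.single ⟨z, hz⟩ 1, ?_, ?_⟩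
      · rw [Fintype.mem_piFinset]
        intro a
        have h1 := Finset.mem_range.mp (hf a)
        rw [Finset.mem_range, Pi.add_apply, Pi.single_apply]
        split_ifs <;> omega
      · simp only [Pi.add_apply, pow_add, Finset.prod_mul_distrib]
        congr 1
        rw [Finset.prod_eq_single ⟨z, hz⟩]
        · simp
        · intro b _ hb; simp [Pi.single_eq_of_ne hb]
        · simp
  calc (P ^ k).coeff.support.card ≤ (B k).card := Finset.card_le_card (hsub k)
    _ ≤ _ := Finset.card_image_le
    _ = _ := by simp [Fintype.card_piFinset]

/-- Evaluation at a completely multiplicative function bounded by one is bounded by the supremum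
on the imaginary axis. -/
lemma norm_lift_le_of_dirichletEval_le (φ : ℕ+ →* ℂ) (hφ : ∀ n, ‖φ n‖ ≤ 1)
    (P : MonoidAlgebra ℂ ℕ+) (M : ℝ) (h : ∀ t : ℝ, ‖dirichletEval (t * Complex.I) P‖ ≤ M) :
    ‖MonoidAlgebra.lift ℂ ℂ ℕ+ φ P‖ ≤ M := by
  set x := ‖MonoidAlgebra.lift ℂ ℂ ℕ+ φ P‖ with hx
  set N := P.coeff.support.card
  have hM : 0 ≤ M := (norm_nonneg _).trans (h 0)
  have hbound (k : ℕ) : x ^ k ≤ ((k : ℝ) + 1) ^ N * M ^ k := by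
    have hc := norm_coeff_le_of_dirichletEval_le (P ^ k) (M ^ k) fun t => by
      rw [map_pow, norm_pow]; exact pow_le_pow_left₀ (norm_nonneg _) (h t) k
    rw [hx, ← norm_pow, ← map_pow, MonoidAlgebra.lift_apply', Finsupp.sum]
    calc _ ≤ ∑ n ∈ (P ^ k).coeff.support, M ^ k := by
          refine norm_sum_le_of_le _ fun n _ => ?_
          rw [norm_mul, Algebra.algebraMap_self, RingHom.id_apply]
          exact (mul_le_of_le_one_right (norm_nonneg _) (hφ n)).trans (hc n)
      _ = ((P ^ k).coeff.support.card : ℝ) * M ^ k := by rw [Finset.sum_const, nsmul_eq_mul]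
      _ ≤ _ := by
          refine mul_le_mul_of_nonneg_right ?_ (pow_nonneg hM k)
          exact_mod_cast card_support_coeff_pow_le P k
  by_contra! hlt
  have hx0 : 0 < x := hM.trans_lt hlt
  obtain ⟨y, hMy, hyx⟩ := exists_between hlt
  have hy : 0 < y := hM.trans_lt hMy
  have hr : 1 < x / y := (one_lt_div hy).mpr hyx
  have hlim := (tendsto_pow_const_div_const_pow_of_one_lt N hr).comp (tendsto_add_atTop_nat 1)
  have hpos : 0 < (x / y)⁻¹ := by positivity
  obtain ⟨k, hk⟩ := (hlim.eventually_lt_const hpos).exists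
  simp only [Function.comp_apply, Nat.cast_add, Nat.cast_one] at hk
  have h1 := hbound k
  have h2 : ((k : ℝ) + 1) ^ N * M ^ k ≤ ((k : ℝ) + 1) ^ N * y ^ k := by gcongr
  have h3 : (x / y) ^ k ≤ ((k : ℝ) + 1) ^ N := by
    rw [div_pow, div_le_iff₀ (by positivity)]; exact h1.trans h2
  rw [div_lt_iff₀ (by positivity), pow_succ', inv_mul_cancel_left₀ (by positivity)] at hk
  linarith

/-- A Dirichlet polynomial is Lipschitz in the real part on the right half-plane. -/
lemma exists_lipschitz_dirichletEval (P : MonoidAlgebra ℂ ℕ+) :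
    ∃ C : ℝ, 0 ≤ C ∧ ∀ σ τ t : ℝ, 0 ≤ σ → σ ≤ τ →
      ‖dirichletEval (τ + t * Complex.I) P - dirichletEval (σ + t * Complex.I) P‖ ≤
        C * (τ - σ) := by
  induction P using MonoidAlgebra.induction_linear with
  | zero => exact ⟨0, le_rfl, by simp⟩
  | add P Q hP hQ =>
    obtain ⟨C, hC, hP⟩ := hP
    obtain ⟨D, hD, hQ⟩ := hQ
    refine ⟨C + D, add_nonneg hC hD, fun σ τ t h0 h => ?_⟩
    rw [map_add, map_add, add_sub_add_comm, add_mul]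
    exact norm_add_le_of_le (hP σ τ t h0 h) (hQ σ τ t h0 h)
  | single n c =>
    have hL := Real.log_natCast_nonneg (n : ℕ)
    refine ⟨‖c‖ * Real.log (n : ℕ), mul_nonneg (norm_nonneg _) hL, fun σ τ t h0 h => ?_⟩
    have heq : cpowHom (τ + t * Complex.I) n =
        cpowHom (σ + t * Complex.I) n * (Real.exp (-((τ - σ) * Real.log (n : ℕ))) : ℝ) := by
      rw [cpowHom_eq_exp, cpowHom_eq_exp, Complex.ofReal_exp, ← Complex.exp_add]
      push_cast; ring_nf
    have h1 := Real.add_one_le_exp (-((τ - σ) * Real.log (n : ℕ)))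
    have h2 : Real.exp (-((τ - σ) * Real.log (n : ℕ))) ≤ 1 :=
      Real.exp_le_one_iff.mpr (by nlinarith)
    rw [dirichletEval_single, dirichletEval_single, ← mul_sub, norm_mul, mul_assoc, heq,
      ← mul_sub_one, norm_mul]
    refine mul_le_mul_of_nonneg_left ?_ (norm_nonneg _)
    refine (mul_le_of_le_one_left (norm_nonneg _)
      (norm_cpowHom_le_one (by simpa using h0) n)).trans ?_
    rw [← Complex.ofReal_one, ← Complex.ofReal_sub, Complex.norm_real, Real.norm_eq_abs, abs_le]
    constructor <;> nlinarith

/-- A Dirichlet polynomial tends to a constant, uniformly as the real part tends to infinity. -/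
lemma exists_eventually_dirichletEval_sub_le (P : MonoidAlgebra ℂ ℕ+) :
    ∃ c : ℂ, ∀ η : ℝ, 0 < η → ∀ᶠ σ : ℝ in atTop, ∀ t : ℝ,
      ‖dirichletEval (σ + t * Complex.I) P - c‖ ≤ η := by
  induction P using MonoidAlgebra.induction_linear with
  | zero => exact ⟨0, fun η hη => .of_forall fun σ t => by simpa using hη.le⟩
  | add P Q hP hQ =>
    obtain ⟨c, hP⟩ := hP
    obtain ⟨d, hQ⟩ := hQ
    refine ⟨c + d, fun η hη => ?_⟩
    filter_upwards [hP _ (half_pos hη), hQ _ (half_pos hη)] with σ h1 h2 t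
    rw [map_add, add_sub_add_comm, ← add_halves η]
    exact norm_add_le_of_le (h1 t) (h2 t)
  | single n c =>
    rcases eq_or_ne n 1 with rfl | hn
    · refine ⟨c, fun η hη => .of_forall fun σ t => ?_⟩
      rw [dirichletEval_single, map_one, mul_one, sub_self, norm_zero]
      exact hη.le
    · refine ⟨0, fun η hη => ?_⟩
      have hL : 0 < Real.log (n : ℕ) := Real.log_pos (by
        have : 1 < (n : ℕ) := by
          have := n.pos
          have : (n : ℕ) ≠ 1 := fun h => hn (PNat.coe_injective h)
          omega
        exact_mod_cast this)
      have hlim : Tendsto (fun σ : ℝ => ‖c‖ * Real.exp (-σ * Real.log (n : ℕ))) atTop (𝓝 0) := by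
        have := (Real.tendsto_exp_atBot.comp
          (tendsto_neg_atTop_atBot.atBot_mul_const hL)).const_mul ‖c‖
        simpa using this
      filter_upwards [hlim.eventually_le_const hη] with σ h t
      rw [dirichletEval_single, sub_zero, norm_mul, norm_cpowHom]
      simpa using h

/-- Approximate inverses on a vertical line can be improved to arbitrary precision. -/
lemma exists_approx_inverse_of_half (P : MonoidAlgebra ℂ ℕ+) (σ : ℝ)
    (h : ∃ Q, ∀ t : ℝ, ‖1 - dirichletEval (σ + t * Complex.I) P *
      dirichletEval (t * Complex.I) Q‖ ≤ 1 / 2) {η : ℝ} (hη : 0 < η) :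
    ∃ Q, ∀ t : ℝ, ‖1 - dirichletEval (σ + t * Complex.I) P *
      dirichletEval (t * Complex.I) Q‖ ≤ η := by
  obtain ⟨Q, hQ⟩ := h
  obtain ⟨k, hk⟩ := exists_pow_lt_of_lt_one hη (by norm_num : (1 / 2 : ℝ) < 1)
  set W := 1 - dirichletShift σ P * Q with hW
  obtain ⟨R, hR⟩ := sub_dvd_pow_sub_pow 1 W k
  refine ⟨Q * R, fun t => ?_⟩
  have : dirichletShift σ P * (Q * R) = 1 - W ^ k := by
    rw [one_pow] at hR
    rw [hR, hW, sub_sub_cancel, mul_assoc]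
  rw [← dirichletEval_shift, ← map_mul, this, map_sub, map_one, sub_sub_cancel, map_pow, norm_pow,
    hW, map_sub, map_mul, map_one, dirichletEval_shift]
  exact (pow_le_pow_left₀ (norm_nonneg _) (hQ t) k).trans hk.le

/-- A Dirichlet polynomial bounded away from zero on the right half-plane has an approximate
inverse on the imaginary axis. -/
lemma exists_approx_inverse (P : MonoidAlgebra ℂ ℕ+) {δ : ℝ} (hδ : 0 < δ)
    (hP : ∀ s : ℂ, 0 ≤ s.re → δ ≤ ‖dirichletEval s P‖) :
    ∃ Q, ∀ t : ℝ, ‖1 - dirichletEval (t * Complex.I) P * dirichletEval (t * Complex.I) Q‖ ≤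
      1 / 2 := by
  obtain ⟨C, hC, hLip⟩ := exists_lipschitz_dirichletEval P
  obtain ⟨c, hc⟩ := exists_eventually_dirichletEval_sub_le P
  set h : ℝ := δ / (4 * (C + 1)) with hh
  have hpos : 0 < h := by positivity
  have hCh : C * h ≤ δ / 4 := by
    rw [hh, mul_div_assoc', div_le_div_iff₀ (by positivity) (by norm_num)]
    nlinarith
  have step (σ τ : ℝ) (h0 : 0 ≤ σ) (h1 : σ ≤ τ) (h2 : τ - σ ≤ h)
      (hτ : ∃ Q, ∀ t : ℝ, ‖1 - dirichletEval (τ + t * Complex.I) P *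
        dirichletEval (t * Complex.I) Q‖ ≤ 1 / 2) :
      ∃ Q, ∀ t : ℝ, ‖1 - dirichletEval (σ + t * Complex.I) P *
        dirichletEval (t * Complex.I) Q‖ ≤ 1 / 2 := by
    obtain ⟨Q, hQ⟩ := exists_approx_inverse_of_half P τ hτ (η := 1 / 8) (by norm_num)
    refine ⟨Q, fun t => ?_⟩
    have hlow := hP (τ + t * Complex.I) (by simpa using h0.trans h1)
    have hdiff := (hLip σ τ t h0 h1).trans ((mul_le_mul_of_nonneg_left h2 hC).trans hCh)
    have hq := hQ t
    set p := dirichletEval (τ + t * Complex.I) P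
    set p' := dirichletEval (σ + t * Complex.I) P
    set q := dirichletEval (t * Complex.I) Q
    have hpq : ‖p‖ * ‖q‖ ≤ 9 / 8 := by
      rw [← norm_mul]
      calc ‖p * q‖ = ‖1 - (1 - p * q)‖ := by rw [sub_sub_cancel]
        _ ≤ ‖(1 : ℂ)‖ + ‖1 - p * q‖ := norm_sub_le _ _
        _ ≤ _ := by rw [norm_one]; linarith
    have hδq : δ * ‖q‖ ≤ 9 / 8 :=
      (mul_le_mul_of_nonneg_right hlow (norm_nonneg _)).trans hpq
    have hdq : ‖p - p'‖ * ‖q‖ ≤ δ / 4 * ‖q‖ := mul_le_mul_of_nonneg_right hdiff (norm_nonneg _)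
    calc ‖1 - p' * q‖ = ‖(1 - p * q) + (p - p') * q‖ := by ring_nf
      _ ≤ ‖1 - p * q‖ + ‖p - p'‖ * ‖q‖ := by rw [← norm_mul]; exact norm_add_le _ _
      _ ≤ 1 / 2 := by linarith
  have far : ∃ n : ℕ, ∃ Q, ∀ t : ℝ, ‖1 - dirichletEval ((n * h : ℝ) + t * Complex.I) P *
      dirichletEval (t * Complex.I) Q‖ ≤ 1 / 2 := by
    have ht : Tendsto (fun n : ℕ => (n : ℝ) * h) atTop atTop :=
      tendsto_natCast_atTop_atTop.atTop_mul_const hpos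
    obtain ⟨n, hn⟩ := (ht.eventually (hc (δ / 4) (by positivity))).exists
    have hcδ : 3 * δ / 4 ≤ ‖c‖ := by
      have h1 := hP ((n * h : ℝ) + (0 : ℝ) * Complex.I) (by simp; positivity)
      have h2 := norm_sub_norm_le (dirichletEval ((n * h : ℝ) + (0 : ℝ) * Complex.I) P) c
      have h3 := hn 0
      linarith
    have hc0 : c ≠ 0 := norm_pos_iff.mp (by linarith)
    refine ⟨n, single 1 c⁻¹, fun t => ?_⟩
    rw [dirichletEval_single, map_one, mul_one, ← mul_inv_cancel₀ hc0, ← sub_mul, norm_mul,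
      norm_inv, norm_sub_rev, ← div_eq_mul_inv, div_le_iff₀ (by linarith)]
    linarith [hn t]
  obtain ⟨n, hn⟩ := far
  have down : ∃ Q, ∀ t : ℝ, ‖1 - dirichletEval (((0 : ℕ) * h : ℝ) + t * Complex.I) P *
      dirichletEval (t * Complex.I) Q‖ ≤ 1 / 2 := by
    refine Nat.decreasingInduction (motive := fun m _ => ∃ Q, ∀ t : ℝ,
      ‖1 - dirichletEval ((m * h : ℝ) + t * Complex.I) P *
        dirichletEval (t * Complex.I) Q‖ ≤ 1 / 2) (fun m _ ih => ?_) hn (Nat.zero_le n)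
    refine step _ _ (by positivity) ?_ ?_ ih <;> push_cast <;> linarith
  simpa using down

/-- If a Dirichlet polynomial vanishes at a completely multiplicative function bounded by one,
then it takes arbitrarily small values on the right half-plane. -/
lemma exists_norm_dirichletEval_lt (φ : ℕ+ →* ℂ) (hφ : ∀ n, ‖φ n‖ ≤ 1)
    (P : MonoidAlgebra ℂ ℕ+) (h0 : MonoidAlgebra.lift ℂ ℂ ℕ+ φ P = 0) {δ : ℝ} (hδ : 0 < δ) :
    ∃ s : ℂ, 0 ≤ s.re ∧ ‖dirichletEval s P‖ < δ := by
  by_contra! hP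
  obtain ⟨Q, hQ⟩ := exists_approx_inverse P hδ hP
  have := norm_lift_le_of_dirichletEval_le φ hφ (1 - P * Q) (1 / 2) fun t => by
    simpa using hQ t
  rw [map_sub, map_mul, h0, zero_mul, map_one, sub_zero, norm_one] at this
  norm_num at this

/-- A series dominated by `b` is within the tail of `b` of its partial sum. -/
lemma norm_tsum_sub_sum_le {ι : Type*} {b : ι → ℝ} (hb : Summable b) {u : ι → ℂ}
    (hu : ∀ i, ‖u i‖ ≤ b i) (s : Finset ι) :
    ‖∑' i, u i - ∑ i ∈ s, u i‖ ≤ ∑' i : { i // i ∉ s }, b i := by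
  rw [← (hb.of_norm_bounded hu).sum_add_tsum_subtype_compl s, add_sub_cancel_left]
  exact tsum_of_norm_bounded (hb.subtype _).hasSum fun i => hu i


/-- For `k ∈ L¹(ρ)` and any completely multiplicative `ψ` with `|ψ| ≤ ρ`, the value
`Σ k(n)·conj(ψ(n))` can be approximated arbitrarily well by values
`Σ k(n)ρ(n)n^{−s}` with `Re s ≥ 0`. -/
theorem dirichlet_laplace_approx (ρ : ℕ → ℝ) (k : ℕ → ℂ)
    (hρ_pos : ∀ n, 1 ≤ n → 0 < ρ n) (hρ1 : ρ 1 = 1)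
    (hρ_mul : ∀ m n, 1 ≤ m → 1 ≤ n → ρ (m * n) = ρ m * ρ n)
    (hk : Summable fun n : ℕ+ => ‖k (n : ℕ)‖ * ρ (n : ℕ)) :
    ∀ ψ : ℕ → ℂ, ψ 1 = 1 → (∀ m n, 1 ≤ m → 1 ≤ n → ψ (m * n) = ψ m * ψ n) →
      (∀ n, 1 ≤ n → ‖ψ n‖ ≤ ρ n) →
      ∀ ε : ℝ, 0 < ε → ∃ s : ℂ, 0 ≤ s.re ∧
        ‖(∑' n : ℕ+, k (n : ℕ) * (starRingEnd ℂ) (ψ (n : ℕ))) -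
          ∑' n : ℕ+, k (n : ℕ) * (ρ (n : ℕ) : ℂ) * ((n : ℕ) : ℂ) ^ (-s)‖ < ε := by
  intro ψ hψ1 hψ_mul hψ_le ε hε
  have hρ (n : ℕ+) : 0 < ρ n := hρ_pos n n.pos
  let φ : ℕ+ →* ℂ :=
    { toFun n := (starRingEnd ℂ) (ψ n) / (ρ n : ℂ)
      map_one' := by simp [hψ1, hρ1]
      map_mul' m n := by
        rw [PNat.mul_coe, hψ_mul m n m.pos n.pos, hρ_mul m n m.pos n.pos, map_mul,
          Complex.ofReal_mul, mul_div_mul_comm] }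
  have hφ (n : ℕ+) : ‖φ n‖ ≤ 1 := by
    change ‖(starRingEnd ℂ) (ψ n) / (ρ n : ℂ)‖ ≤ 1
    rw [norm_div, RCLike.norm_conj, Complex.norm_real, Real.norm_of_nonneg (hρ n).le]
    exact div_le_one_of_le₀ (hψ_le n n.pos) (hρ n).le
  have hρφ (n : ℕ+) : k n * (ρ n : ℂ) * φ n = k n * (starRingEnd ℂ) (ψ n) := by
    rw [mul_assoc]
    exact congrArg _ (mul_div_cancel₀ _ (Complex.ofReal_ne_zero.mpr (hρ n).ne'))
  have hnorm (n : ℕ+) (z : ℂ) (hz : ‖z‖ ≤ 1) : ‖k n * (ρ n : ℂ) * z‖ ≤ ‖k n‖ * ρ n := by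
    rw [norm_mul, norm_mul, Complex.norm_real, Real.norm_of_nonneg (hρ n).le]
    exact mul_le_of_le_one_right (mul_nonneg (norm_nonneg _) (hρ n).le) hz
  obtain ⟨S, hS⟩ := ((tendsto_tsum_compl_atTop_zero fun n : ℕ+ => ‖k n‖ * ρ n).eventually_lt_const
    (by positivity : 0 < ε / 3)).exists
  let A : MonoidAlgebra ℂ ℕ+ := ∑ n ∈ S, single n (k n * (ρ n : ℂ))
  have hA (χ : ℕ+ →* ℂ) :
      MonoidAlgebra.lift ℂ ℂ ℕ+ χ A = ∑ n ∈ S, k n * (ρ n : ℂ) * χ n := by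
    simp [A]
  set w := MonoidAlgebra.lift ℂ ℂ ℕ+ φ A with hw
  obtain ⟨s, hs, hlt⟩ := exists_norm_dirichletEval_lt φ hφ (A - algebraMap ℂ _ w)
    (by rw [map_sub, AlgHom.commutes]; exact sub_self w) (by positivity : 0 < ε / 3)
  rw [map_sub, AlgHom.commutes, Algebra.algebraMap_self, RingHom.id_apply, dirichletEval, hA] at hlt
  refine ⟨s, hs, ?_⟩
  have h1 := norm_tsum_sub_sum_le hk (fun n => hnorm n (φ n) (hφ n)) S
  have h2 := norm_tsum_sub_sum_le hk
    (fun n => hnorm n (cpowHom s n) (norm_cpowHom_le_one hs n)) S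
  rw [← hA, ← hw] at h1
  simp only [hρφ] at h1
  change ‖_ - ∑' n : ℕ+, k n * (ρ n : ℂ) * cpowHom s n‖ < ε
  set x := ∑' n : ℕ+, k n * (starRingEnd ℂ) (ψ n)
  set y := ∑' n : ℕ+, k n * (ρ n : ℂ) * cpowHom s n
  set v := ∑ n ∈ S, k n * (ρ n : ℂ) * cpowHom s n
  calc ‖x - y‖ = ‖(x - w) - (v - w) - (y - v)‖ := by ring_nf
    _ ≤ ‖x - w‖ + ‖v - w‖ + ‖y - v‖ :=
      (norm_sub_le _ _).trans (add_le_add_left (norm_sub_le _ _) _)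
    _ < ε := by linarith
end

section
/- Let p₁ < p₂ < ... < p_r be distinct prime numbers, let φ₁, ..., φ_r be real numbers, and let ε > 0. Then there exists t ∈ ℝ such that |e^{iφ_j} − p_j^{it}| < ε for all j = 1, ..., r, where p_j^{it} = e^{it·log p_j}. -/
open MeasureTheory

namespace UnitAddTorus

variable {d : Type*} [Fintype d]

lemma mFourier_apply_add (n : d → ℤ) (x y : UnitAddTorus d) :
    mFourier n (x + y) = mFourier n x * mFourier n y := by
  simp [mFourier, fourier_apply, smul_add, AddCircle.toCircle_add, Finset.prod_mul_distrib]

lemma mFourier_apply_coe (n : d → ℤ) (x : d → ℝ) :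
    mFourier n (fun i ↦ (x i : UnitAddCircle)) =
      Complex.exp (2 * Real.pi * Complex.I * ∑ i, (n i : ℂ) * x i) := by
  simp only [mFourier, ContinuousMap.coe_mk, fourier_coe_apply, ← Complex.exp_sum, Finset.mul_sum]
  congr 1
  refine Finset.sum_congr rfl fun i _ ↦ ?_
  push_cast
  ring

/-- A finite measure on the torus is determined by its Fourier coefficients. -/
lemma measure_ext_of_integral_mFourier {μ ν : Measure (UnitAddTorus d)}
    [IsFiniteMeasure μ] [IsFiniteMeasure ν]
    (h : ∀ n : d → ℤ, ∫ x, mFourier n x ∂μ = ∫ x, mFourier n x ∂ν) : μ = ν := by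
  have integral_toLp (ρ : Measure (UnitAddTorus d)) [IsFiniteMeasure ρ]
      (f : C(UnitAddTorus d, ℂ)) : ∫ x, ContinuousMap.toLp 1 ρ ℂ f x ∂ρ = ∫ x, f x ∂ρ :=
    integral_congr_ae (ContinuousMap.coeFn_toLp ρ f)
  have continuous_integral_apply (ρ : Measure (UnitAddTorus d)) [IsFiniteMeasure ρ] :
      Continuous fun f : C(UnitAddTorus d, ℂ) ↦ ∫ x, f x ∂ρ := by
    simp_rw [← integral_toLp ρ]
    exact continuous_integral.comp (ContinuousMap.toLp 1 ρ ℂ).continuous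
  have integrable_apply (ρ : Measure (UnitAddTorus d)) [IsFiniteMeasure ρ]
      (f : C(UnitAddTorus d, ℂ)) : Integrable f ρ :=
    f.continuous.integrable_of_hasCompactSupport (HasCompactSupport.of_compactSpace f)
  have integral_eq (f : C(UnitAddTorus d, ℂ)) : ∫ x, f x ∂μ = ∫ x, f x ∂ν := by
    have hf : f ∈ closure (Submodule.span ℂ (Set.range (mFourier (d := d))) : Set _) := by
      rw [← Submodule.topologicalClosure_coe, span_mFourier_closure_eq_top]
      trivial
    refine closure_minimal (fun g hg ↦ ?_)
      (isClosed_eq (continuous_integral_apply μ) (continuous_integral_apply ν)) hf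
    induction hg using Submodule.span_induction with
    | mem g hg => obtain ⟨n, rfl⟩ := hg; exact h n
    | zero => simp
    | add f g _ _ hf hg =>
      simp only [Set.mem_ofPred_eq, ContinuousMap.add_apply] at hf hg ⊢
      rw [integral_add (integrable_apply _ f) (integrable_apply _ g),
        integral_add (integrable_apply _ f) (integrable_apply _ g), hf, hg]
    | smul c f _ hf =>
      simp only [Set.mem_ofPred_eq, ContinuousMap.smul_apply] at hf ⊢
      rw [integral_smul, integral_smul, hf]
  refine ext_of_forall_integral_eq_of_IsFiniteMeasure fun f ↦ ?_
  have := integral_eq ⟨fun x ↦ (f x : ℂ), by fun_prop⟩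
  simpa only [ContinuousMap.coe_mk, integral_complex_ofReal, Complex.ofReal_inj] using this

/-- A character that is nontrivial on the image of a group has vanishing integral against any
invariant measure on that group. -/
lemma integral_mFourier_comp_eq_zero {G : Type*} [AddGroup G] [MeasurableSpace G]
    [MeasurableAdd G] (μ : Measure G) [μ.IsAddLeftInvariant] (ι : G →+ UnitAddTorus d)
    {n : d → ℤ} {g : G} (hg : mFourier n (ι g) ≠ 1) : ∫ x, mFourier n (ι x) ∂μ = 0 := by
  have h := integral_add_left_eq_self (μ := μ) (fun x ↦ mFourier n (ι x)) g
  simp only [map_add, mFourier_apply_add, integral_const_mul] at h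
  exact (mul_left_eq_self₀.mp h).resolve_left hg

/-- A closed subgroup of the torus that is annihilated by no nontrivial character is everything. -/
lemma addSubgroup_eq_top_of_mFourier_ne_one {H : AddSubgroup (UnitAddTorus d)}
    (hH : IsClosed (H : Set (UnitAddTorus d)))
    (hchar : ∀ n : d → ℤ, n ≠ 0 → ∃ x ∈ H, mFourier n x ≠ 1) : H = ⊤ := by
  have : CompactSpace H := isCompact_iff_compactSpace.mp hH.isCompact
  let μ : Measure H := Measure.addHaarMeasure ⊤
  let ν : Measure (UnitAddTorus d) := Measure.addHaarMeasure ⊤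
  have : IsProbabilityMeasure μ := ⟨Measure.addHaarMeasure_self (K₀ := ⊤)⟩
  have : IsProbabilityMeasure ν := ⟨Measure.addHaarMeasure_self (K₀ := ⊤)⟩
  have hμ : IsProbabilityMeasure (μ.map ((↑) : H → UnitAddTorus d)) :=
    Measure.isProbabilityMeasure_map measurable_subtype_coe.aemeasurable
  have hmap : μ.map ((↑) : H → UnitAddTorus d) = ν := by
    refine measure_ext_of_integral_mFourier fun n ↦ ?_
    rcases eq_or_ne n 0 with rfl | hn
    · simp only [mFourier_zero, ContinuousMap.one_apply, integral_const, probReal_univ]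
    · obtain ⟨x, hxH, hx⟩ := hchar n hn
      rw [integral_map measurable_subtype_coe.aemeasurable
          (mFourier n).continuous.aestronglyMeasurable,
        show ∫ y : H, mFourier n y ∂μ = 0 from
          integral_mFourier_comp_eq_zero μ H.subtype (g := ⟨x, hxH⟩) hx]
      exact (integral_mFourier_comp_eq_zero ν (AddMonoidHom.id _) hx).symm
  have hcompl : ν (H : Set (UnitAddTorus d))ᶜ = 0 := by
    rw [← hmap, Measure.map_apply measurable_subtype_coe hH.measurableSet.compl]
    convert measure_empty (μ := μ)
    ext x
    simp
  rw [hH.isOpen_compl.measure_eq_zero_iff ν, Set.compl_empty_iff] at hcompl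
  exact SetLike.coe_injective (hcompl.trans AddSubgroup.coe_top.symm)

/-- The **Kronecker theorem**, continuous form: a line in the torus whose slopes are linearly
independent over `ℤ` is dense. -/
theorem denseRange_line {a : d → ℝ} (ha : LinearIndependent ℤ a) :
    DenseRange fun (t : ℝ) (i : d) ↦ ((t * a i : ℝ) : UnitAddCircle) := by
  let ι : ℝ →+ UnitAddTorus d :=
    { toFun := fun t i ↦ ((t * a i : ℝ) : UnitAddCircle)
      map_zero' := by ext; simp
      map_add' := fun s t ↦ by ext; simp [add_mul] }
  suffices h : ι.range.topologicalClosure = ⊤ by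
    have := congrArg (fun H : AddSubgroup (UnitAddTorus d) ↦ (H : Set (UnitAddTorus d))) h
    exact dense_iff_closure_eq.mpr this
  refine addSubgroup_eq_top_of_mFourier_ne_one
    ι.range.isClosed_topologicalClosure fun n hn ↦ ?_
  have hs : ∑ i, n i * a i ≠ 0 := fun h ↦
    hn (funext (Fintype.linearIndependent_iff.mp ha n (by simpa using h)))
  set s : ℝ := ∑ i, n i * a i with hs_def
  refine ⟨ι (1 / (2 * s)), ι.range.le_topologicalClosure ⟨_, rfl⟩, ?_⟩
  have hsum : ∑ i, (n i : ℂ) * ((1 / (2 * s) * a i : ℝ) : ℂ) = 1 / 2 := by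
    have : ∑ i, (n i : ℝ) * (1 / (2 * s) * a i) = 1 / 2 := by
      simp_rw [mul_left_comm _ (1 / (2 * s)), ← Finset.mul_sum, ← hs_def]
      field_simp
    simpa using congrArg ((↑) : ℝ → ℂ) this
  have hι : mFourier n (ι (1 / (2 * s))) = -1 := by
    refine (mFourier_apply_coe n fun i ↦ 1 / (2 * s) * a i).trans ?_
    rw [hsum, ← Complex.exp_pi_mul_I]
    congr 1
    ring
  rw [hι]
  norm_num

end UnitAddTorus

/-- The logarithms of distinct primes are linearly independent over `ℤ`. -/
theorem linearIndependent_log_of_prime {ι : Type*} [Fintype ι] {p : ι → ℕ}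
    (hp : ∀ j, (p j).Prime) (hinj : Function.Injective p) :
    LinearIndependent ℤ fun j ↦ Real.log (p j) := by
  classical
  refine Fintype.linearIndependent_iff.mpr fun n hn i ↦ ?_
  have hpos (j : ι) : (0 : ℝ) < (p j : ℝ) ^ n j := zpow_pos (mod_cast (hp j).pos) _
  have hprod : ∏ j, (p j : ℚ) ^ n j = 1 := by
    have hlog : Real.log (∏ j, (p j : ℝ) ^ n j) = 0 := by
      rw [Real.log_prod fun j _ ↦ (hpos j).ne']
      simpa [Real.log_zpow] using hn
    have := Real.eq_one_of_pos_of_log_eq_zero (Finset.prod_pos fun j _ ↦ hpos j) hlog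
    rw [← Rat.cast_inj (α := ℝ)]
    simpa using this
  have : Fact (p i).Prime := ⟨hp i⟩
  have padicValRat_prod (s : Finset ι) : padicValRat (p i) (∏ j ∈ s, (p j : ℚ) ^ n j) =
      ∑ j ∈ s, n j * padicValRat (p i) (p j) := by
    have hne (j : ι) : (p j : ℚ) ^ n j ≠ 0 := zpow_ne_zero _ (mod_cast (hp j).ne_zero)
    induction s using Finset.induction_on with
    | empty => simp
    | insert j s hj ih =>
      rw [Finset.prod_insert hj, Finset.sum_insert hj,
        padicValRat.mul (hne j) (Finset.prod_ne_zero_iff.mpr fun k _ ↦ hne k), ih,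
        padicValRat.zpow]
  have hval := padicValRat_prod Finset.univ
  rw [hprod, padicValRat.one, Finset.sum_eq_single i] at hval
  · simpa [padicValRat.self (hp i).one_lt] using hval.symm
  · intro j _ hji
    have : Fact (p j).Prime := ⟨hp j⟩
    rw [padicValRat.of_nat, padicValNat_primes (hinj.ne hji.symm)]
    simp
  · simp

/-- Simultaneous approximation: for distinct primes `p₁ < ... < p_r`, real numbers
`φ₁, ..., φ_r` and `ε > 0` there is `t ∈ ℝ` with `|e^{iφ_j} − p_j^{it}| < ε` for all `j`. -/
theorem kronecker_primes (r : ℕ) (p : Fin r → ℕ) (hp : ∀ j, (p j).Prime)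
    (hmono : StrictMono p) (φ : Fin r → ℝ) (ε : ℝ) (hε : 0 < ε) :
    ∃ t : ℝ, ∀ j : Fin r,
      ‖Complex.exp (Complex.I * (φ j : ℂ)) -
        Complex.exp (Complex.I * (t : ℂ) * (Real.log (p j) : ℂ))‖ < ε := by
  let U : Set (UnitAddTorus (Fin r)) :=
    {x | ∀ j, ‖Complex.exp (Complex.I * (φ j : ℂ)) - fourier 1 (x j)‖ < ε}
  have hU : IsOpen U := by
    simp only [U, Set.ofPred_forall]
    exact isOpen_iInter_of_finite fun j ↦ isOpen_lt (by fun_prop) continuous_const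
  have hφ : (fun j ↦ ((φ j / (2 * Real.pi) : ℝ) : UnitAddCircle)) ∈ U := by
    intro j
    have : 2 * Real.pi * Complex.I * (1 : ℤ) * ((φ j / (2 * Real.pi) : ℝ) : ℂ) / (1 : ℝ) =
        Complex.I * φ j := by
      have := Complex.ofReal_ne_zero.mpr Real.pi_ne_zero
      push_cast
      field_simp
    rw [fourier_coe_apply, this]
    simpa using hε
  obtain ⟨t, ht⟩ := (UnitAddTorus.denseRange_line
    (linearIndependent_log_of_prime hp hmono.injective)).exists_mem_open hU ⟨_, hφ⟩
  refine ⟨2 * Real.pi * t, fun j ↦ ?_⟩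
  have hj := ht j
  rw [fourier_coe_apply] at hj
  convert hj using 4
  push_cast
  ring
end

section
/- Let P be a set and let S = P →₀ ℕ be the free commutative monoid on P (finitely supported functions from P to ℕ under pointwise addition, with identity the zero function). Let N : S → (0,∞) be a homomorphism from the additive monoid S to the multiplicative group of positive reals (N(a + b) = N(a)·N(b), N(0) = 1) such that N(δ_p) > 1 for every p ∈ P, where δ_p is the indicator of the singleton p. Then the family (1/N(δ_p))_{p∈P} is summable if and only if the family (1/N(s))_{s∈S} is summable; equivalently, Σ_{p∈P} 1/N(δ_p) diverges if and only if Σ_{s∈S} 1/N(s) diverges. -/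
/-- A power of a generator weighs the corresponding power of the weight. -/
theorem map_single_eq_pow_of_map_add {P R : Type*} [CommMonoid R] (N : (P →₀ ℕ) → R)
    (hN_zero : N 0 = 1) (hN_add : ∀ a b, N (a + b) = N a * N b) (p : P) (k : ℕ) :
    N (Finsupp.single p k) = N (Finsupp.single p 1) ^ k := by
  induction k with
  | zero => simp [hN_zero]
  | succ k ih => rw [Finsupp.single_add, hN_add, ih, pow_succ]

/-- A homomorphism out of the free commutative monoid is determined by the generators. -/
theorem map_eq_finsuppProd_of_map_add {P R : Type*} [CommMonoid R] (N : (P →₀ ℕ) → R)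
    (hN_zero : N 0 = 1) (hN_add : ∀ a b, N (a + b) = N a * N b) (s : P →₀ ℕ) :
    N s = s.prod fun p k => N (Finsupp.single p 1) ^ k := by
  induction s using Finsupp.induction_linear with
  | zero => simp [hN_zero]
  | add f g hf hg =>
    rw [hN_add, hf, hg, Finsupp.prod_add_index' (fun _ => pow_zero _) fun _ _ _ => pow_add _ _ _]
  | single p k =>
    rw [Finsupp.prod_single_index (h := fun p k => N (Finsupp.single p 1) ^ k) (pow_zero _),
      map_single_eq_pow_of_map_add N hN_zero hN_add]

/-- A finite partial sum of monomials is bounded by an Euler product. -/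
theorem exists_sum_finsuppProd_pow_le_prod_inv {P : Type*} {x : P → ℝ} (hx0 : ∀ p, 0 ≤ x p)
    (hx1 : ∀ p, x p < 1) (F : Finset (P →₀ ℕ)) :
    ∃ T : Finset P, ∑ s ∈ F, s.prod (fun p k => x p ^ k) ≤ ∏ p ∈ T, (1 - x p)⁻¹ := by
  classical
  obtain ⟨T, hsupp⟩ : ∃ T : Finset P, ∀ s ∈ F, s.support ⊆ T :=
    ⟨F.biUnion Finsupp.support, fun s hs => Finset.subset_biUnion_of_mem _ hs⟩
  let r : (P →₀ ℕ) → (∀ p ∈ T, ℕ) := fun s p _ => s p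
  have hinj : Set.InjOn r F := by
    intro s hs t ht h
    ext p
    by_cases hp : p ∈ T
    · exact congr_fun (congr_fun h p) hp
    · rw [Finsupp.notMem_support_iff.mp fun h' => hp (hsupp s hs h'),
        Finsupp.notMem_support_iff.mp fun h' => hp (hsupp t ht h')]
  refine ⟨T, ?_⟩
  calc ∑ s ∈ F, s.prod (fun p k => x p ^ k)
      = ∑ s ∈ F, ∏ p ∈ T.attach, x p ^ r s p p.2 := by
        refine Finset.sum_congr rfl fun s hs => ?_
        rw [Finsupp.prod_of_support_subset s (hsupp s hs) _ fun _ _ => pow_zero _]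
        exact (Finset.prod_attach T fun p => x p ^ s p).symm
    _ = ∑ e ∈ F.image r, ∏ p ∈ T.attach, x p ^ e p p.2 := by
        rw [Finset.sum_image hinj]
    _ ≤ ∑ e ∈ T.pi fun p => F.image fun s => s p, ∏ p ∈ T.attach, x p ^ e p p.2 := by
        refine Finset.sum_le_sum_of_subset_of_nonneg ?_ fun e _ _ =>
          Finset.prod_nonneg fun p _ => pow_nonneg (hx0 p) _
        intro e he
        obtain ⟨s, hs, rfl⟩ := Finset.mem_image.mp he
        exact Finset.mem_pi.mpr fun p _ => Finset.mem_image_of_mem _ hs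
    _ = ∏ p ∈ T, ∑ k ∈ F.image (fun s => s p), x p ^ k :=
        (Finset.prod_sum T (fun p => F.image fun s => s p) fun p k => x p ^ k).symm
    _ ≤ ∏ p ∈ T, (1 - x p)⁻¹ := by
        refine Finset.prod_le_prod
          (fun p _ => Finset.sum_nonneg fun k _ => pow_nonneg (hx0 p) k) fun p _ => ?_
        rw [← tsum_geometric_of_lt_one (hx0 p) (hx1 p)]
        exact (summable_geometric_of_lt_one (hx0 p) (hx1 p)).sum_le_tsum _
          fun k _ => pow_nonneg (hx0 p) k

theorem Summable.div_one_sub {P : Type*} {x : P → ℝ} (hx0 : ∀ p, 0 ≤ x p)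
    (hx : Summable x) : Summable fun p => x p / (1 - x p) := by
  refine Summable.of_norm_bounded_eventually (hx.mul_left 2) ?_
  filter_upwards [hx.tendsto_cofinite_zero.eventually_lt_const (by norm_num : (0 : ℝ) < 1 / 2)]
    with p hp
  have h : 0 < 1 - x p := by linarith
  rw [Real.norm_of_nonneg (div_nonneg (hx0 p) h.le), div_le_iff₀ h]
  nlinarith [hx0 p]

/-- If the generators have summable weights in `[0, 1)`, then so do all monomials. -/
theorem Summable.finsuppProd_pow {P : Type*} {x : P → ℝ} (hx0 : ∀ p, 0 ≤ x p)
    (hx1 : ∀ p, x p < 1) (hx : Summable x) :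
    Summable fun s : P →₀ ℕ => s.prod fun p k => x p ^ k := by
  have hy0 : ∀ p, 0 ≤ x p / (1 - x p) := fun p => div_nonneg (hx0 p) (sub_nonneg.mpr (hx1 p).le)
  refine summable_of_sum_le (c := Real.exp (∑' p, x p / (1 - x p)))
    (fun s => Finset.prod_nonneg fun p _ => pow_nonneg (hx0 p) _) fun F => ?_
  obtain ⟨T, hT⟩ := exists_sum_finsuppProd_pow_le_prod_inv hx0 hx1 F
  calc _ ≤ ∏ p ∈ T, (1 - x p)⁻¹ := hT
    _ ≤ ∏ p ∈ T, Real.exp (x p / (1 - x p)) := by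
        refine Finset.prod_le_prod (fun p _ => inv_nonneg.mpr (sub_nonneg.mpr (hx1 p).le))
          fun p _ => ?_
        have h : 1 - x p ≠ 0 := (sub_pos.mpr (hx1 p)).ne'
        calc (1 - x p)⁻¹ = x p / (1 - x p) + 1 := by field_simp; ring
          _ ≤ _ := Real.add_one_le_exp _
    _ = Real.exp (∑ p ∈ T, x p / (1 - x p)) := (Real.exp_sum _ _).symm
    _ ≤ _ := Real.exp_le_exp.mpr ((hx.div_one_sub hx0).sum_le_tsum _ fun p _ => hy0 p)

/-- Let `S = P →₀ ℕ` be the free commutative monoid on `P` and `N : S → (0,∞)` a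
norm (a homomorphism into the positive reals with `N(δ_p) > 1` for each generator).
Then `Σ_p 1/N(δ_p)` converges iff `Σ_s 1/N(s)` converges. -/
theorem free_monoid_norm_summable_iff (P : Type*) (N : (P →₀ ℕ) → ℝ)
    (hN_pos : ∀ s, 0 < N s)
    (hN_zero : N 0 = 1)
    (hN_add : ∀ a b, N (a + b) = N a * N b)
    (hN_gen : ∀ p : P, 1 < N (Finsupp.single p 1)) :
    Summable (fun p : P => 1 / N (Finsupp.single p 1)) ↔
      Summable (fun s : P →₀ ℕ => 1 / N s) := by
  refine ⟨fun h => ?_, fun h =>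
    h.comp_injective (i := fun p => Finsupp.single p 1) (Finsupp.single_left_injective one_ne_zero)⟩
  have hprod := h.finsuppProd_pow (fun p => (one_div_pos.mpr (hN_pos _)).le)
    fun p => (div_lt_one (hN_pos _)).mpr (hN_gen p)
  refine hprod.congr fun s => ?_
  exact (map_eq_finsuppProd_of_map_add (fun s => 1 / N s) (by simp [hN_zero])
    (fun a b => by rw [hN_add, one_div_mul_one_div]) s).symm
end

section
/- Let K be a number field. Then the sum Σ_{𝔭} 1/N(𝔭), taken over all nonzero prime ideals 𝔭 of the ring of integers of K, diverges (the family (1/N(𝔭))_{𝔭} is not summable), where N(𝔭) denotes the absolute norm of the ideal 𝔭. -/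
open UniqueFactorizationMonoid Filter in
/-- A finite sum of a nonnegative multiplicative function over nonzero ideals is bounded by the
product of truncated geometric series over the prime ideals dividing one of them. -/
theorem sum_ideals_le_prod_sum_pow {R : Type*} [CommRing R] [IsDedekindDomain R]
    [DecidableEq (Ideal R)] (f : Ideal R →* ℝ) (hf : ∀ I, 0 ≤ f I)
    (T : Finset (Ideal R)) (hT : ∀ I ∈ T, I ≠ ⊥) :
    ∃ M : ℕ, ∑ I ∈ T, f I ≤
      ∏ p ∈ T.biUnion (fun I => (normalizedFactors I).toFinset),
        ∑ e ∈ Finset.range M, f p ^ e := by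
  set P := T.biUnion (fun I => (normalizedFactors I).toFinset)
  refine ⟨∑ I ∈ T, (normalizedFactors I).card + 1, ?_⟩
  set M := ∑ I ∈ T, (normalizedFactors I).card + 1 with hM
  rw [Finset.prod_sum]
  let c : Ideal R → (p : Ideal R) → p ∈ P → ℕ := fun I p _ => (normalizedFactors I).count p
  have hprod : ∀ I ∈ T, I = ∏ p ∈ P, p ^ (normalizedFactors I).count p := by
    intro I hI
    have hsub : (normalizedFactors I).toFinset ⊆ P :=
      Finset.subset_biUnion_of_mem (fun I => (normalizedFactors I).toFinset) hI
    rw [← Finset.prod_multiset_count_of_subset _ _ hsub]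
    exact (Ideal.prod_normalizedFactors_eq_self (hT I hI)).symm
  have hval : ∀ I ∈ T, f I = ∏ p ∈ P.attach, f p.1 ^ c I p.1 p.2 := by
    intro I hI
    conv_lhs => rw [hprod I hI, map_prod, ← Finset.prod_attach]
    simp [c]
  have hinj : Set.InjOn c T := by
    intro I hI J hJ h
    rw [hprod I hI, hprod J hJ]
    refine Finset.prod_congr rfl fun p hp => ?_
    have : c I p hp = c J p hp := by rw [h]
    simp only [c] at this
    rw [this]
  have hmem : ∀ I ∈ T, c I ∈ P.pi fun _ => Finset.range M := by
    intro I hI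
    simp only [Finset.mem_pi, Finset.mem_range]
    intro p _
    have h₁ := Multiset.count_le_card p (normalizedFactors I)
    have h₂ := Finset.single_le_sum (f := fun I => (normalizedFactors I).card)
      (fun _ _ => Nat.zero_le _) hI
    simp only [c]
    omega
  calc ∑ I ∈ T, f I = ∑ I ∈ T, ∏ p ∈ P.attach, f p.1 ^ c I p.1 p.2 :=
        Finset.sum_congr rfl hval
    _ = ∑ g ∈ T.image c, ∏ p ∈ P.attach, f p.1 ^ g p.1 p.2 := by
        rw [Finset.sum_image hinj]
    _ ≤ _ := Finset.sum_le_sum_of_subset_of_nonneg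
        (Finset.image_subset_iff.mpr hmem)
        fun g _ _ => Finset.prod_nonneg fun p _ => pow_nonneg (hf _) _

/-- A truncated geometric series with ratio in `[0, 1/2]` is at most `exp (2 * x)`. -/
theorem sum_range_pow_le_exp_two_mul {x : ℝ} (h₀ : 0 ≤ x) (h₁ : x ≤ 1 / 2) (M : ℕ) :
    ∑ e ∈ Finset.range M, x ^ e ≤ Real.exp (2 * x) := by
  have hlt : x < 1 := by linarith
  calc ∑ e ∈ Finset.range M, x ^ e ≤ (1 - x)⁻¹ := by
        rw [← tsum_geometric_of_lt_one h₀ hlt]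
        exact (summable_geometric_of_lt_one h₀ hlt).sum_le_tsum _ fun _ _ => by positivity
    _ ≤ 2 * x + 1 := by
        rw [inv_le_iff_one_le_mul₀ (by linarith)]
        nlinarith
    _ ≤ Real.exp (2 * x) := Real.add_one_le_exp _

open NumberField Filter Topology nonZeroDivisors in
/-- The sum of `1 / N(I)` over the nonzero ideals of the ring of integers diverges. -/
theorem not_summable_one_div_absNorm_ideals (K : Type*) [Field K] [NumberField K] :
    ¬ Summable (fun I : (Ideal (𝓞 K))⁰ => (1 : ℝ) / (Ideal.absNorm (I : Ideal (𝓞 K)) : ℝ)) := by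
  classical
  intro h
  have hl := dedekindZeta_residue_pos K
  have hlim := NumberField.Ideal.tendsto_norm_le_div_atTop₀ K
  rw [← dedekindZeta_residue_def] at hlim
  set l := dedekindZeta_residue K
  have hN : ∀ I : (Ideal (𝓞 K))⁰, (0 : ℝ) < Ideal.absNorm (I : Ideal (𝓞 K)) := fun I =>
    Nat.cast_pos.mpr (Ideal.absNorm_pos_of_nonZeroDivisors I)
  obtain ⟨F, hF⟩ := summable_iff_vanishing_norm.mp h (l / 2) (half_pos hl)
  have hlim₂ : Tendsto (fun s : ℝ => (F.card : ℝ) / s + l / 2) atTop (𝓝 (0 + l / 2)) :=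
    (tendsto_const_nhds.div_atTop tendsto_id).add_const _
  have hle := le_of_tendsto_of_tendsto hlim hlim₂ (by
    filter_upwards [eventually_gt_atTop 0] with s hs
    have hfin : {I : (Ideal (𝓞 K))⁰ | (Ideal.absNorm (I : Ideal (𝓞 K)) : ℝ) ≤ s}.Finite := by
      simp_rw [← Nat.le_floor_iff hs.le]
      exact Ideal.finite_setOfPred_absNorm_le₀ ⌊s⌋₊
    have hcard : Nat.card {I : (Ideal (𝓞 K))⁰ // (Ideal.absNorm (I : Ideal (𝓞 K)) : ℝ) ≤ s} =
        hfin.toFinset.card := Nat.card_eq_card_finite_toFinset hfin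
    have h₁ : ((hfin.toFinset \ F).card : ℝ) ≤ s * (l / 2) := by
      calc ((hfin.toFinset \ F).card : ℝ) = ∑ I ∈ hfin.toFinset \ F, (1 : ℝ) := by simp
        _ ≤ ∑ I ∈ hfin.toFinset \ F, s * (1 / (Ideal.absNorm (I : Ideal (𝓞 K)) : ℝ)) := by
            refine Finset.sum_le_sum fun I hI => ?_
            have hI' : (Ideal.absNorm (I : Ideal (𝓞 K)) : ℝ) ≤ s := by
              simpa using (Finset.mem_sdiff.mp hI).1
            rw [mul_one_div]
            exact (one_le_div (hN I)).mpr hI'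
        _ ≤ s * (l / 2) := by
            rw [← Finset.mul_sum]
            refine mul_le_mul_of_nonneg_left ?_ hs.le
            exact (le_abs_self _).trans (hF _ Finset.sdiff_disjoint).le
    have h₂ : (hfin.toFinset.card : ℝ) ≤ F.card + (hfin.toFinset \ F).card := by
      have := Finset.card_le_card_sdiff_add_card (s := hfin.toFinset) (t := F)
      rw [add_comm] at this
      exact_mod_cast this
    rw [hcard, div_add' _ _ _ hs.ne']
    gcongr
    linarith)
  linarith

/-- For a number field `K`, the sum `Σ_𝔭 1/N(𝔭)` over the nonzero prime ideals of
the ring of integers of `K` diverges. -/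
theorem sum_one_div_norm_primes_not_summable (K : Type*) [Field K] [NumberField K] :
    ¬ Summable (fun 𝔭 : {I : Ideal (NumberField.RingOfIntegers K) // I.IsPrime ∧ I ≠ ⊥} =>
      (1 : ℝ) / (Ideal.absNorm 𝔭.1 : ℝ)) := by
  classical
  intro h
  let f : Ideal (NumberField.RingOfIntegers K) →* ℝ :=
    { toFun := fun I => (1 : ℝ) / (Ideal.absNorm I : ℝ)
      map_one' := by simp
      map_mul' := fun I J => by simp [mul_comm] }
  have hf : ∀ I, 0 ≤ f I := fun I => by simp only [f, MonoidHom.coe_mk, OneHom.coe_mk]; positivity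
  let S : Set (Ideal (NumberField.RingOfIntegers K)) := {I | I.IsPrime ∧ I ≠ ⊥}
  have hS : Summable (S.indicator f) := summable_subtype_iff_indicator.mp h
  have hhalf : ∀ p ∈ S, f p ≤ 1 / 2 := by
    rintro p ⟨hp, hp₀⟩
    have h₀ : Ideal.absNorm p ≠ 0 := by rwa [Ne, Ideal.absNorm_eq_zero_iff]
    have h₁ : Ideal.absNorm p ≠ 1 := by
      rw [Ne, Ideal.absNorm_eq_one_iff]
      exact hp.ne_top
    have h₂ : (2 : ℝ) ≤ Ideal.absNorm p := by
      exact_mod_cast (by omega : 2 ≤ Ideal.absNorm p)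
    exact one_div_le_one_div_of_le two_pos h₂
  refine not_summable_one_div_absNorm_ideals K
    (summable_of_sum_le (c := Real.exp (2 * ∑' I, S.indicator f I)) (fun I => hf I) fun T => ?_)
  obtain ⟨M, hM⟩ := sum_ideals_le_prod_sum_pow f hf (T.map (Function.Embedding.subtype _)) (by
    intro I hI
    obtain ⟨J, -, rfl⟩ := Finset.mem_map.mp hI
    exact nonZeroDivisors.ne_zero J.2)
  rw [Finset.sum_map] at hM
  refine hM.trans ?_
  set P := (T.map (Function.Embedding.subtype _)).biUnion
    (fun I => (UniqueFactorizationMonoid.normalizedFactors I).toFinset)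
  have hPS : ∀ p ∈ P, p ∈ S := by
    intro p hp
    obtain ⟨I, -, hI⟩ := Finset.mem_biUnion.mp hp
    have hprime :=
      UniqueFactorizationMonoid.prime_of_normalized_factor p (Multiset.mem_toFinset.mp hI)
    exact ⟨Ideal.isPrime_of_prime hprime, hprime.ne_zero⟩
  calc ∏ p ∈ P, ∑ e ∈ Finset.range M, f p ^ e ≤ ∏ p ∈ P, Real.exp (2 * S.indicator f p) := by
        refine Finset.prod_le_prod
          (fun p _ => Finset.sum_nonneg fun e _ => pow_nonneg (hf p) e) fun p hp => ?_
        rw [Set.indicator_of_mem (hPS p hp)]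
        exact sum_range_pow_le_exp_two_mul (hf p) (hhalf p (hPS p hp)) M
    _ = Real.exp (2 * ∑ p ∈ P, S.indicator f p) := by
        rw [← Real.exp_sum, Finset.mul_sum]
    _ ≤ Real.exp (2 * ∑' I, S.indicator f I) := by
        gcongr
        exact hS.sum_le_tsum _ fun I _ => Set.indicator_nonneg (fun I _ => hf I) I
end

section
/- There exists a function K : ℕ₊ → ℂ with Σ_{n=1}^∞ |K(n)| < ∞ such that: (i) for every completely multiplicative function ψ : ℕ₊ → ℂ with |ψ(n)| ≤ 1 for all n, one has Σ_{n=1}^∞ K(n)·conj(ψ(n)) ≠ −1; and (ii) there exists a bounded function f : ℕ₊ → ℝ such that f(n) + Σ_{d | n} K(d) f(n/d) = 1 for all n ≥ 1, yet f(n) does not converge to any limit as n → ∞. (Hence the Tauberian theorem for Dirichlet convolution fails for nonzero limits.) -/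
/-- The Tauberian theorem for the Dirichlet convolution fails for nonzero limits:
there is `K ∈ ℓ¹(ℕ₊)` whose Laplace transform avoids `−1` on all bounded
completely multiplicative `ψ`, and a bounded `f` with `f + K∗f = 1` such that
`f` has no limit at infinity. -/
theorem tauberian_fails_nonzero_limit :
    ∃ K : ℕ → ℂ, Summable (fun n : ℕ+ => ‖K (n : ℕ)‖) ∧
      (∀ ψ : ℕ → ℂ, ψ 1 = 1 → (∀ m n, 1 ≤ m → 1 ≤ n → ψ (m * n) = ψ m * ψ n) →
        (∀ n, 1 ≤ n → ‖ψ n‖ ≤ 1) →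
        (∑' n : ℕ+, K (n : ℕ) * (starRingEnd ℂ) (ψ (n : ℕ))) ≠ -1) ∧
      ∃ f : ℕ → ℝ, (∃ C, ∀ n, |f n| ≤ C) ∧
        (∀ n, 1 ≤ n → (f n : ℂ) + ∑ d ∈ n.divisors, K d * (f (n / d) : ℂ) = 1) ∧
        ¬ ∃ L : ℝ, Filter.Tendsto f Filter.atTop (nhds L) := by
  have ne_two : ∀ n : ℕ+, n ≠ 2 → (n : ℕ) ≠ 2 := fun n hn h => hn (PNat.eq h)
  refine ⟨fun n => if n = 2 then 1 / 2 else 0, ?_, ?_,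
    fun n => 2 / 3 + 1 / 3 * (-1 / 2) ^ padicValNat 2 n, ⟨1, fun n => ?_⟩, ?_, ?_⟩
  · refine summable_of_ne_finset_zero (s := {2}) fun n hn => ?_
    simp [ne_two n (by simpa using hn)]
  · intro ψ _ _ hψ h
    rw [tsum_eq_single 2 fun n hn => by simp [ne_two n hn]] at h
    have h2 := hψ 2 one_le_two
    have h3 := congrArg norm h
    simp at h3
    linarith
  · have h : |(-1 / 2 : ℝ) ^ padicValNat 2 n| ≤ 1 := by
      rw [abs_pow]
      exact pow_le_one₀ (abs_nonneg _) (by norm_num [abs_le])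
    rw [abs_le] at h ⊢
    constructor <;> linarith
  · intro n hn
    simp only [ite_mul, zero_mul, Finset.sum_ite_eq', Nat.mem_divisors]
    by_cases h : 2 ∣ n
    · obtain ⟨m, rfl⟩ := h
      have hm : m ≠ 0 := by omega
      simp [hm, pow_succ]
      ring
    · simp [h, padicValNat.eq_zero_of_not_dvd h]
      norm_num
  · rintro ⟨L, hL⟩
    have odd_val (n : ℕ) : padicValNat 2 (2 * n + 1) = 0 :=
      padicValNat.eq_zero_of_not_dvd (by omega)
    have tendsto_odd : Filter.Tendsto (fun n : ℕ => 2 * n + 1) Filter.atTop Filter.atTop :=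
      Filter.tendsto_atTop_mono (fun n => by dsimp only [id]; omega) Filter.tendsto_id
    have tendsto_twice_odd :
        Filter.Tendsto (fun n : ℕ => 2 * (2 * n + 1)) Filter.atTop Filter.atTop :=
      Filter.tendsto_atTop_mono (fun n => by dsimp only [id]; omega) Filter.tendsto_id
    have h1 := hL.comp tendsto_odd
    have h2 := hL.comp tendsto_twice_odd
    simp only [Function.comp_def, odd_val, ne_eq, OfNat.ofNat_ne_zero, not_false_eq_true,
      Nat.add_eq_zero_iff, one_ne_zero, and_false, padicValNat.mul, padicValNat_self] at h1 h2
    have e1 := tendsto_nhds_unique h1 tendsto_const_nhds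
    have e2 := tendsto_nhds_unique h2 tendsto_const_nhds
    norm_num [e1] at e2
end

section
/- Let k : [0,∞) → ℂ be integrable (k ∈ L¹(0,∞)) and suppose that ∫_0^∞ k(x) e^{−zx} dx ≠ −1 for every z ∈ ℂ with Re z ≥ 0. Let f : [0,∞) → ℂ be measurable and essentially bounded, and let s ∈ ℂ. If f(x) + ∫_0^x f(x−y) k(y) dy → s as x → +∞ (i.e., for every ε > 0 there is R such that the expression has absolute value within ε of s for almost every x > R), then f(x) → s/(1 + ∫_0^∞ k(y) dy) as x → +∞ in the same sense. -/
open MeasureTheory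

open Filter Topology

/-- Continuity of translation in `L¹(ℝ)`. -/
lemma tendsto_integral_norm_translate_sub {k : ℝ → ℂ} (hk : Integrable k) :
    Tendsto (fun h : ℝ => ∫ y, ‖k (y + h) - k y‖) (𝓝 0) (𝓝 0) := by
  have hk1 : MemLp k 1 := memLp_one_iff_integrable.2 hk
  have hcont : Continuous fun h : ℝ => DomAddAct.mk h +ᵥ hk1.toLp k := by
    have : Fact ((1 : ENNReal) ≠ ⊤) := ⟨ENNReal.one_ne_top⟩
    exact DomAddAct.continuous_mk.vadd continuous_const
  have hlim : Tendsto (fun h : ℝ => ‖(DomAddAct.mk h +ᵥ hk1.toLp k) - hk1.toLp k‖)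
      (𝓝 0) (𝓝 0) := by
    have h2 : Continuous fun h : ℝ => ‖(DomAddAct.mk h +ᵥ hk1.toLp k) - hk1.toLp k‖ := by
      fun_prop
    simpa using h2.tendsto 0
  refine hlim.congr fun h => ?_
  rw [DomAddAct.mk_vadd_toLp, ← MemLp.toLp_sub, L1.norm_eq_integral_norm]
  refine integral_congr_ae ?_
  filter_upwards [MemLp.coeFn_toLp ((hk1.comp_measurePreserving
    (measurePreserving_vadd h volume)).sub hk1)] with y hy
  refine (congrArg norm hy).trans ?_
  simp [add_comm]

lemma exists_integral_norm_sub_translate_lt {k : ℝ → ℂ} (hk : Integrable k) {ε : ℝ} (hε : 0 < ε) :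
    ∃ δ > 0, ∀ s t : ℝ, |s - t| < δ → ∫ y, ‖k (y - t) - k (y - s)‖ < ε := by
  obtain ⟨δ, hδ, h⟩ := Metric.tendsto_nhds_nhds.1 (tendsto_integral_norm_translate_sub hk) ε hε
  refine ⟨δ, hδ, fun s t hst => ?_⟩
  have h1 := h (x := s - t) (by simpa using hst)
  have h2 : ∫ y, ‖k (y - t) - k (y - s)‖ = ∫ y, ‖k (y + (s - t)) - k y‖ := by
    rw [← integral_sub_right_eq_self (fun y => ‖k (y + (s - t)) - k y‖) s]
    congr 1; ext y; congr 3; ring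
  rw [h2]
  rw [dist_zero_right] at h1
  exact (le_abs_self _).trans_lt h1

/-- A continuous multiplicative map `ℝ → ℂ` is an exponential. -/
lemma exists_eq_exp_of_continuous_of_map_add {χ : ℝ → ℂ} (hc : Continuous χ) (h0 : χ 0 = 1)
    (hadd : ∀ s t, χ (s + t) = χ s * χ t) : ∃ c : ℂ, ∀ t : ℝ, χ t = Complex.exp (c * t) := by
  have hderiv (t : ℝ) : HasDerivAt (fun t => ∫ y in (0 : ℝ)..t, χ y) (χ t) t :=
    intervalIntegral.integral_hasDerivAt_right (hc.intervalIntegrable _ _)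
      (hc.stronglyMeasurableAtFilter _ _) hc.continuousAt
  obtain ⟨a, ha⟩ : ∃ a : ℝ, ∫ y in (0 : ℝ)..a, χ y ≠ 0 := by
    by_contra! h
    have h1 := hderiv 0
    rw [show (fun t : ℝ => ∫ y in (0 : ℝ)..t, χ y) = fun _ => 0 from funext h] at h1
    exact one_ne_zero (h0 ▸ h1.unique (hasDerivAt_const 0 0))
  have hχ (t : ℝ) : χ t = ((∫ y in (0 : ℝ)..(t + a), χ y) - ∫ y in (0 : ℝ)..t, χ y) /
      ∫ y in (0 : ℝ)..a, χ y := by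
    rw [eq_div_iff ha, intervalIntegral.integral_interval_sub_left (hc.intervalIntegrable _ _)
      (hc.intervalIntegrable _ _), ← intervalIntegral.integral_const_mul]
    simp_rw [← hadd]
    rw [intervalIntegral.integral_comp_add_left χ t, add_zero]
  obtain ⟨c, hc0⟩ : ∃ c, HasDerivAt χ c 0 := by
    refine ⟨(χ (0 + a) - χ 0) / ∫ y in (0 : ℝ)..a, χ y, ?_⟩
    have h1 := (((hderiv (0 + a)).comp_add_const 0 a).sub (hderiv 0)).div_const
      (∫ y in (0 : ℝ)..a, χ y)
    exact h1.congr_of_eventuallyEq (Eventually.of_forall hχ)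
  have hd (t : ℝ) : HasDerivAt χ (χ t * c) t := by
    have h1 : HasDerivAt (fun x => χ (x - t)) c t := by
      refine HasDerivAt.comp_sub_const t t ?_
      simpa using hc0
    refine (h1.const_mul (χ t)).congr_of_eventuallyEq (Eventually.of_forall fun x => ?_)
    simp [← hadd]
  have he (t : ℝ) : HasDerivAt (fun x : ℝ => Complex.exp (-(c * x)))
      (Complex.exp (-(c * t)) * (-c)) t := by
    have h1 : HasDerivAt (fun x : ℝ => -(c * (x : ℂ))) (-c) t := by
      simpa using ((Complex.ofRealCLM.hasDerivAt (x := t)).const_mul c).fun_neg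
    exact h1.cexp
  have hconst : ∀ t, χ t * Complex.exp (-(c * t)) = χ 0 * Complex.exp (-(c * (0 : ℝ))) := by
    intro t
    refine is_const_of_deriv_eq_zero (f := fun t : ℝ => χ t * Complex.exp (-(c * t)))
      (fun x => ((hd x).fun_mul (he x)).differentiableAt) (fun x => ?_) t 0
    rw [((hd x).fun_mul (he x)).deriv]; ring
  refine ⟨c, fun t => ?_⟩
  have h1 := hconst t
  rw [h0, Complex.exp_neg] at h1
  have h2 := Complex.exp_ne_zero (c * t)
  field_simp at h1
  simpa using h1

lemma re_eq_zero_of_norm_exp_mul_le {c : ℂ} {M : ℝ}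
    (h : ∀ t : ℝ, ‖Complex.exp (c * t)‖ ≤ M) : c.re = 0 := by
  by_contra hc
  have h1 := h ((M + 1) / c.re)
  rw [Complex.norm_exp] at h1
  have h2 : (c * (((M + 1) / c.re : ℝ) : ℂ)).re = M + 1 := by
    rw [Complex.re_mul_ofReal]; field_simp
  rw [h2] at h1
  linarith [Real.add_one_le_exp (M + 1)]

/-- If `U` is a bounded continuous representation of `ℝ` in a commutative Banach algebra and the
Fourier transform of `k ∈ L¹` avoids `-1`, then `1 + ∫ k(t) U(t) dt` is invertible. -/
lemma isUnit_one_add_integral_smul {A : Type*} [NormedCommRing A] [NormedAlgebra ℂ A]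
    [CompleteSpace A] {U : ℝ → A} (hU : Continuous U) (h0 : U 0 = 1)
    (hadd : ∀ s t, U (s + t) = U s * U t) {M : ℝ} (hM : ∀ t, ‖U t‖ ≤ M)
    {k : ℝ → ℂ} (hk : Integrable k)
    (hk' : ∀ c : ℂ, c.re = 0 → ∫ t : ℝ, k t * Complex.exp (c * t) ≠ -1) :
    IsUnit (1 + ∫ t, k t • U t) := by
  by_contra hunit
  obtain ⟨φ, hφ⟩ := WeakDual.CharacterSpace.exists_apply_eq_zero hunit
  let ψ : A →L[ℂ] ℂ := WeakDual.CharacterSpace.toCLM φ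
  have hψ (a : A) : φ a = ψ a := rfl
  obtain ⟨c, hc⟩ := exists_eq_exp_of_continuous_of_map_add (χ := fun t => φ (U t))
    (ψ.continuous.comp hU) (by simp [h0]) (by simp [hadd])
  have hre : c.re = 0 := by
    refine re_eq_zero_of_norm_exp_mul_le (M := ‖ψ‖ * M) fun t => ?_
    rw [← hc t]
    exact (ψ.le_opNorm _).trans (by gcongr; exact hM t)
  refine hk' c hre ?_
  have hint : Integrable fun t => k t • U t :=
    hk.smul_bdd M hU.aestronglyMeasurable (Eventually.of_forall hM)
  rw [map_add, map_one, hψ, ← ψ.integral_comp_comm hint] at hφ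
  rw [← add_eq_zero_iff_eq_neg, add_comm, ← hφ]
  congr 2
  ext t
  rw [map_smul, ← hc t, smul_eq_mul, hψ]

/-- Version of `isUnit_one_add_integral_smul` in a possibly non-commutative algebra. -/
lemma isUnit_one_add_integral_smul' {A : Type*} [NormedRing A] [NormedAlgebra ℂ A]
    [CompleteSpace A] {U : ℝ → A} (hU : Continuous U) (h0 : U 0 = 1)
    (hadd : ∀ s t, U (s + t) = U s * U t) {M : ℝ} (hM : ∀ t, ‖U t‖ ≤ M)
    {k : ℝ → ℂ} (hk : Integrable k)
    (hk' : ∀ c : ℂ, c.re = 0 → ∫ t : ℝ, k t * Complex.exp (c * t) ≠ -1) :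
    IsUnit (1 + ∫ t, k t • U t) := by
  let B : Subalgebra ℂ A := Subalgebra.centralizer ℂ (Subalgebra.centralizer ℂ (Set.range U))
  have hUB (t : ℝ) : U t ∈ B := Set.subset_centralizer_centralizer ⟨t, rfl⟩
  have hcomm : Set.range U ⊆ (Subalgebra.centralizer ℂ (Set.range U) : Set A) := by
    rintro _ ⟨t, rfl⟩ _ ⟨s, rfl⟩
    rw [← hadd, ← hadd, add_comm]
  have hBclosed : IsClosed (B : Set A) := Set.isClosed_centralizer _
  have : CompleteSpace B := hBclosed.completeSpace_coe
  let _ : NormedCommRing B :=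
    { (inferInstance : NormedRing B) with
      mul_comm := fun x y => Subtype.ext <|
        y.2 _ (Set.centralizer_subset hcomm x.2) }
  let V : ℝ → B := fun t => ⟨U t, hUB t⟩
  have hV : Continuous V := hU.subtype_mk _
  have hunit := isUnit_one_add_integral_smul hV (Subtype.ext h0)
    (fun s t => Subtype.ext (hadd s t)) hM hk hk'
  have h1 := hunit.map B.val
  have : SecondCountableTopologyEither ℝ B := ⟨Or.inl inferInstance⟩
  have hint : Integrable fun t => k t • V t :=
    hk.smul_bdd M hV.aestronglyMeasurable (Eventually.of_forall hM)
  let ι : B →L[ℂ] A := B.toSubmodule.subtypeL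
  have h2 : B.val (∫ t, k t • V t) = ∫ t, k t • U t := (ι.integral_comp_comm hint).symm
  rwa [map_add, map_one, h2] at h1

lemma map_integral_smul {E : Type*} [NormedAddCommGroup E] [NormedSpace ℂ E]
    [CompleteSpace E] {T : ℝ → E →L[ℂ] E}
    (hadd : ∀ s t x, T (s + t) x = T s (T t x)) {k : ℝ → ℂ} {x : E}
    (hx : Integrable fun t => k t • T t x) (t : ℝ) :
    T t (∫ y, k y • T y x) = ∫ y, k y • T (t + y) x := by
  rw [← (T t).integral_comp_comm hx]
  simp [hadd]

/-- If `1 + ∫ k(t) T(t) dt` vanishes for a strongly continuous contractive representation `T` of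
`ℝ` on `E` and the Fourier transform of `k ∈ L¹` avoids `-1`, then `E` is trivial. -/
lemma subsingleton_of_forall_add_integral_smul_eq_zero {E : Type*} [NormedAddCommGroup E]
    [NormedSpace ℂ E] [CompleteSpace E] {T : ℝ → E →L[ℂ] E} (h0 : ∀ x, T 0 x = x)
    (hadd : ∀ s t x, T (s + t) x = T s (T t x)) (hT : ∀ t x, ‖T t x‖ ≤ ‖x‖)
    (hcont : ∀ x, Continuous fun t => T t x) {k : ℝ → ℂ} (hk : Integrable k)
    (hk' : ∀ c : ℂ, c.re = 0 → ∫ t : ℝ, k t * Complex.exp (c * t) ≠ -1)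
    (h : ∀ x, x + ∫ t, k t • T t x = 0) : Subsingleton E := by
  have hint (x : E) {f : ℝ → ℂ} (hf : Integrable f) : Integrable fun t => f t • T t x :=
    hf.smul_bdd ‖x‖ (hcont x).aestronglyMeasurable (Eventually.of_forall fun t => hT t x)
  have hrep (t : ℝ) (x : E) : T t x = -∫ y, k (y - t) • T y x := by
    conv_lhs => rw [eq_neg_of_add_eq_zero_left (h x)]
    rw [map_neg, map_integral_smul hadd (hint x hk),
      ← integral_add_left_eq_self (fun y => k (y - t) • T y x) t]
    simp
  have hdist (s t : ℝ) : ‖T t - T s‖ ≤ ∫ y, ‖k (y - t) - k (y - s)‖ := by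
    refine ContinuousLinearMap.opNorm_le_bound _ (integral_nonneg fun _ => norm_nonneg _)
      fun x => ?_
    have h1 : (T t - T s) x = -∫ y, (k (y - t) - k (y - s)) • T y x := by
      rw [sub_apply, hrep t, hrep s]
      simp_rw [sub_smul]
      rw [integral_sub (hint x (hk.comp_sub_right t)) (hint x (hk.comp_sub_right s))]
      abel
    rw [h1, norm_neg, ← integral_mul_const]
    refine norm_integral_le_of_norm_le
      (((hk.comp_sub_right t).sub (hk.comp_sub_right s)).norm.mul_const _)
      (Eventually.of_forall fun y => ?_)
    rw [norm_smul]
    exact mul_le_mul_of_nonneg_left (hT _ _) (norm_nonneg _)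
  have hTcont : Continuous T := by
    refine Metric.continuous_iff.2 fun s ε hε => ?_
    obtain ⟨δ, hδ, hδ'⟩ := exists_integral_norm_sub_translate_lt hk hε
    refine ⟨δ, hδ, fun t hts => ?_⟩
    rw [dist_eq_norm]
    exact (hdist s t).trans_lt (hδ' s t (by rwa [abs_sub_comm]))
  have hTnorm (t : ℝ) : ‖T t‖ ≤ 1 :=
    ContinuousLinearMap.opNorm_le_bound _ zero_le_one fun x => by
      rw [one_mul]; exact hT t x
  have hunit := isUnit_one_add_integral_smul' hTcont (ContinuousLinearMap.ext h0)
    (fun s t => ContinuousLinearMap.ext (hadd s t)) hTnorm hk hk'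
  have hTint : Integrable fun t => k t • T t :=
    hk.smul_bdd 1 hTcont.aestronglyMeasurable (Eventually.of_forall hTnorm)
  have hzero : 1 + ∫ t, k t • T t = 0 := by
    ext x
    rw [add_apply, ContinuousLinearMap.integral_apply hTint]
    exact h x
  rw [hzero, isUnit_zero_iff] at hunit
  refine ⟨fun x y => ?_⟩
  have hall (z : E) : z = 0 := by
    simpa using (congrArg (fun S : E →L[ℂ] E => S z) hunit).symm
  rw [hall x, hall y]

/-- An abstract Wiener theorem for contractive representations of `ℝ` on a Banach space. -/
lemma eq_zero_of_add_integral_smul_eq_zero {E : Type*} [NormedAddCommGroup E] [NormedSpace ℂ E]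
    [CompleteSpace E] {T : ℝ → E →L[ℂ] E} (h0 : ∀ x, T 0 x = x)
    (hadd : ∀ s t x, T (s + t) x = T s (T t x)) (hT : ∀ t x, ‖T t x‖ ≤ ‖x‖)
    {k : ℝ → ℂ} (hk : Integrable k)
    (hk' : ∀ c : ℂ, c.re = 0 → ∫ t : ℝ, k t * Complex.exp (c * t) ≠ -1)
    {q : E} (hq : Continuous fun t => T t q) (h : q + ∫ t, k t • T t q = 0) : q = 0 := by
  have hint {x : E} (hx : Continuous fun t => T t x) : Integrable fun t => k t • T t x :=
    hk.smul_bdd ‖x‖ hx.aestronglyMeasurable (Eventually.of_forall fun t => hT t x)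
  let N : Submodule ℂ E :=
    { carrier := {x | (Continuous fun t => T t x) ∧ x + ∫ t, k t • T t x = 0}
      zero_mem' := by simp [continuous_const]
      add_mem' := by
        rintro x y ⟨hx, hx'⟩ ⟨hy, hy'⟩
        refine ⟨by simpa using hx.fun_add hy, ?_⟩
        simp only [map_add, smul_add]
        rw [integral_add (hint hx) (hint hy), add_add_add_comm, hx', hy', add_zero]
      smul_mem' := by
        rintro a x ⟨hx, hx'⟩
        refine ⟨by simpa using hx.fun_const_smul a, ?_⟩
        simp only [map_smul, smul_comm _ a]
        rw [integral_smul, ← smul_add, hx', smul_zero] }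
  have hNclosed : IsClosed (N : Set E) := by
    refine IsSeqClosed.isClosed fun u x hu hux => ?_
    have hlim (t : ℝ) : Tendsto (fun n => T t (u n)) atTop (𝓝 (T t x)) :=
      ((T t).continuous.tendsto x).comp hux
    have hx : Continuous fun t => T t x := by
      have hunif : TendstoUniformly (fun n t => T t (u n)) (fun t => T t x) atTop := by
        rw [Metric.tendstoUniformly_iff]
        intro ε hε
        filter_upwards [Metric.tendsto_nhds.1 hux ε hε] with n hn t
        rw [dist_eq_norm, ← map_sub]
        rw [dist_comm, dist_eq_norm] at hn
        exact (hT _ _).trans_lt hn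
      exact hunif.continuous (Frequently.of_forall fun n => (hu n).1)
    refine ⟨hx, ?_⟩
    obtain ⟨M, hM⟩ := hux.norm.bddAbove_range
    have hlim' : Tendsto (fun n => u n + ∫ t, k t • T t (u n)) atTop
        (𝓝 (x + ∫ t, k t • T t x)) := by
      refine hux.add (tendsto_integral_of_dominated_convergence (fun t => ‖k t‖ * M)
        (fun n => (hint (hu n).1).aestronglyMeasurable) (hk.norm.mul_const M)
        (fun n => Eventually.of_forall fun t => ?_)
        (Eventually.of_forall fun t => (hlim t).const_smul (k t)))
      rw [norm_smul]
      gcongr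
      exact (hT _ _).trans (hM ⟨n, rfl⟩)
    refine tendsto_nhds_unique hlim' ?_
    simp_rw [fun n => (hu n).2]
    exact tendsto_const_nhds
  have : CompleteSpace N := hNclosed.completeSpace_coe
  have hmaps (t : ℝ) : Set.MapsTo (T t) N N := by
    rintro x ⟨hx, hx'⟩
    refine ⟨?_, ?_⟩
    · simp_rw [← hadd]
      exact hx.comp (continuous_add_const t)
    · simp_rw [← hadd, add_comm _ t]
      rw [← map_integral_smul hadd (hint hx), ← map_add, hx', map_zero]
  have hNcont (x : N) : Continuous fun t => (T t).restrict (hmaps t) x :=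
    x.2.1.subtype_mk _
  have hNint (x : N) : Integrable fun t => k t • (T t).restrict (hmaps t) x :=
    hk.smul_bdd ‖x‖ (hNcont x).aestronglyMeasurable (Eventually.of_forall fun t => hT t x)
  have hN := subsingleton_of_forall_add_integral_smul_eq_zero
    (T := fun t => (T t).restrict (hmaps t)) (fun x => Subtype.ext (h0 x))
    (fun s t x => Subtype.ext (hadd s t x)) (fun t x => hT t x) hNcont hk hk' fun x => by
      refine Subtype.ext ?_
      have h1 : N.subtypeL (∫ t, k t • (T t).restrict (hmaps t) x) = ∫ t, k t • T t (x : E) :=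
        (N.subtypeL.integral_comp_comm (hNint x)).symm
      exact (congrArg ((x : E) + ·) h1).trans x.2.2
  exact congrArg Subtype.val (hN.elim ⟨q, hq, h⟩ (0 : N))

open scoped BoundedContinuousFunction

/-- Translation `u ↦ u (· - t)` on bounded continuous functions. -/
noncomputable def bcfTranslate (t : ℝ) : (ℝ →ᵇ ℂ) →L[ℂ] (ℝ →ᵇ ℂ) :=
  LinearMap.mkContinuous
    { toFun := fun u => u.compContinuous ⟨fun x => x - t, by fun_prop⟩
      map_add' := fun _ _ => rfl
      map_smul' := fun _ _ => rfl } 1 fun u => by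
    rw [one_mul]
    exact (BoundedContinuousFunction.norm_le (norm_nonneg u)).2 fun x => u.norm_coe_le_norm _

lemma bcfTranslate_apply (t : ℝ) (u : ℝ →ᵇ ℂ) (x : ℝ) : bcfTranslate t u x = u (x - t) := rfl

lemma norm_bcfTranslate_apply_le (t : ℝ) (u : ℝ →ᵇ ℂ) : ‖bcfTranslate t u‖ ≤ ‖u‖ :=
  (BoundedContinuousFunction.norm_le (norm_nonneg u)).2 fun x => u.norm_coe_le_norm (x - t)

lemma continuous_bcfTranslate {u : ℝ →ᵇ ℂ} (hu : UniformContinuous u) :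
    Continuous fun t => bcfTranslate t u := by
  refine Metric.continuous_iff.2 fun s ε hε => ?_
  obtain ⟨δ, hδ, h⟩ := Metric.uniformContinuous_iff.1 hu (ε / 2) (half_pos hε)
  refine ⟨δ, hδ, fun t ht => ?_⟩
  refine lt_of_le_of_lt ((BoundedContinuousFunction.dist_le (half_pos hε).le).2 fun x => ?_)
    (half_lt_self hε)
  refine (h ?_).le
  change dist (x - t) (x - s) < δ
  rwa [dist_sub_left]

/-- The bounded continuous functions on `ℝ` that vanish at `+∞`. -/
def vanishingAtTop : Submodule ℂ (ℝ →ᵇ ℂ) where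
  carrier := {u | Tendsto u atTop (𝓝 0)}
  zero_mem' := tendsto_const_nhds
  add_mem' hu hv := by simpa using! Tendsto.add hu hv
  smul_mem' a _ hu := by simpa using Tendsto.const_smul hu a

lemma mem_vanishingAtTop {u : ℝ →ᵇ ℂ} : u ∈ vanishingAtTop ↔ Tendsto u atTop (𝓝 0) := Iff.rfl

lemma isClosed_vanishingAtTop : IsClosed (vanishingAtTop : Set (ℝ →ᵇ ℂ)) := by
  refine isClosed_of_closure_subset fun u hu => ?_
  refine Metric.tendsto_nhds.2 fun ε hε => ?_
  obtain ⟨v, hv, huv⟩ := Metric.mem_closure_iff.1 hu (ε / 2) (half_pos hε)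
  filter_upwards [Metric.tendsto_nhds.1 (mem_vanishingAtTop.1 hv) (ε / 2) (half_pos hε)] with x hx
  calc dist (u x) 0 ≤ dist (u x) (v x) + dist (v x) 0 := dist_triangle _ _ _
    _ < ε / 2 + ε / 2 :=
      add_lt_add ((BoundedContinuousFunction.dist_coe_le_dist x).trans_lt huv) hx
    _ = ε := add_halves ε

/-- Wiener's Tauberian theorem for bounded uniformly continuous functions. -/
lemma tendsto_zero_of_tendsto_add_convolution {k : ℝ → ℂ} (hk : Integrable k)
    (hk' : ∀ c : ℂ, c.re = 0 → ∫ t : ℝ, k t * Complex.exp (c * t) ≠ -1)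
    {u : ℝ →ᵇ ℂ} (hu : UniformContinuous u)
    (h : Tendsto (fun x => u x + ∫ y, k y * u (x - y)) atTop (𝓝 0)) :
    Tendsto u atTop (𝓝 0) := by
  have : IsClosed (vanishingAtTop : Set (ℝ →ᵇ ℂ)) := isClosed_vanishingAtTop
  have hker (t : ℝ) : vanishingAtTop ≤ (vanishingAtTop.mkQL ∘L bcfTranslate t).ker := by
    intro v hv
    rw [LinearMap.mem_ker]
    refine (Submodule.Quotient.mk_eq_zero _).2 ?_
    exact (mem_vanishingAtTop.1 hv).comp (tendsto_atTop_add_const_right _ (-t) tendsto_id)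
  let T : ℝ → ((ℝ →ᵇ ℂ) ⧸ vanishingAtTop) →L[ℂ] ((ℝ →ᵇ ℂ) ⧸ vanishingAtTop) := fun t =>
    vanishingAtTop.liftQL (vanishingAtTop.mkQL ∘L bcfTranslate t) (hker t)
  have hTmk (t : ℝ) (v : ℝ →ᵇ ℂ) :
      T t (vanishingAtTop.mkQL v) = vanishingAtTop.mkQL (bcfTranslate t v) := rfl
  have hsurj : Function.Surjective vanishingAtTop.mkQL := vanishingAtTop.mkQ_surjective
  have horbit : Continuous fun t => T t (vanishingAtTop.mkQL u) :=
    vanishingAtTop.mkQL.continuous.comp (continuous_bcfTranslate hu)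
  have hint : Integrable fun t => k t • bcfTranslate t u :=
    hk.smul_bdd ‖u‖ (continuous_bcfTranslate hu).aestronglyMeasurable
      (Eventually.of_forall fun t => norm_bcfTranslate_apply_le t u)
  have heval (x : ℝ) : (∫ t, k t • bcfTranslate t u) x = ∫ y, k y * u (x - y) :=
    ((BoundedContinuousFunction.evalCLM ℂ x).integral_comp_comm hint).symm
  refine (Submodule.Quotient.mk_eq_zero vanishingAtTop).1 ?_
  refine eq_zero_of_add_integral_smul_eq_zero (T := T) ?_ ?_ ?_ hk hk' horbit ?_
  · intro x
    obtain ⟨v, rfl⟩ := hsurj x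
    rw [hTmk]
    congr 1
    ext y
    simp [bcfTranslate_apply]
  · intro s t x
    obtain ⟨v, rfl⟩ := hsurj x
    simp_rw [hTmk]
    congr 1
    ext y
    simp [bcfTranslate_apply, sub_sub]
  · intro t x
    refine le_of_forall_pos_lt_add fun ε hε => ?_
    obtain ⟨v, rfl, hv⟩ := Submodule.Quotient.norm_mk_lt x hε
    exact ((Submodule.Quotient.norm_mk_le _ (bcfTranslate t v)).trans
      (norm_bcfTranslate_apply_le t v)).trans_lt hv
  · have heq : ∫ t, k t • T t (vanishingAtTop.mkQL u) =
        vanishingAtTop.mkQL (∫ t, k t • bcfTranslate t u) :=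
      vanishingAtTop.mkQL.integral_comp_comm hint
    refine (congrArg (vanishingAtTop.mkQL u + ·) heq).trans ?_
    refine (map_add vanishingAtTop.mkQL _ _).symm.trans ?_
    refine (Submodule.Quotient.mk_eq_zero _).2 ?_
    refine Tendsto.congr (fun x => ?_) h
    rw [BoundedContinuousFunction.add_apply, heval]

/-- If `g` is essentially bounded and tends essentially to `s` at `+∞`, then so does `k * g` to
`s ∫ k`. -/
lemma tendsto_convolution_of_essentially_tendsto {k g : ℝ → ℂ} {s : ℂ} {C : ℝ}
    (hk : Integrable k) (hg : AEStronglyMeasurable g) (hgC : ∀ᵐ x, ‖g x‖ ≤ C)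
    (h : ∀ ε : ℝ, 0 < ε → ∃ R : ℝ, ∀ᵐ x : ℝ, R < x → ‖g x - s‖ < ε) :
    Tendsto (fun x => ∫ y, k y * g (x - y)) atTop (𝓝 ((∫ y, k y) * s)) := by
  classical
  obtain ⟨S, hS, hgS⟩ : ∃ S : Set ℝ, (∀ᵐ x, x ∈ S) ∧
      Tendsto (fun x => S.piecewise g (fun _ => s) x) atTop (𝓝 s) := by
    choose R hR using fun n : ℕ => h (1 / (n + 1)) Nat.one_div_pos_of_nat
    refine ⟨{x | ∀ n, R n < x → ‖g x - s‖ < 1 / ((n : ℝ) + 1)}, ae_all_iff.2 hR, ?_⟩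
    refine Metric.tendsto_nhds.2 fun ε hε => ?_
    obtain ⟨n, hn⟩ := exists_nat_one_div_lt hε
    filter_upwards [eventually_gt_atTop (R n)] with x hx
    by_cases hxS : x ∈ {x | ∀ n, R n < x → ‖g x - s‖ < 1 / ((n : ℝ) + 1)}
    · rw [Set.piecewise_eq_of_mem _ _ _ hxS, dist_eq_norm]
      exact (hxS n hx).trans hn
    · rwa [Set.piecewise_eq_of_notMem _ _ _ hxS, dist_self]
  set G : ℝ → ℂ := S.piecewise g (fun _ => s)
  have hGg : G =ᵐ[volume] g := by
    filter_upwards [hS] with x hx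
    exact Set.piecewise_eq_of_mem _ _ _ hx
  have hqmp (x : ℝ) : Measure.QuasiMeasurePreserving (fun y => x - y) volume volume :=
    (Measure.measurePreserving_sub_left volume x).quasiMeasurePreserving
  have hGx (x : ℝ) : ∀ᵐ y, G (x - y) = g (x - y) := (hqmp x).ae hGg
  have hlim : Tendsto (fun x => ∫ y, k y * G (x - y)) atTop (𝓝 (∫ y, k y * s)) := by
    refine tendsto_integral_filter_of_dominated_convergence (fun y => ‖k y‖ * C)
      (Eventually.of_forall fun x => hk.aestronglyMeasurable.mul ?_)
      (Eventually.of_forall fun x => ?_) (hk.norm.mul_const C)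
      (Eventually.of_forall fun y => ?_)
    · exact (hg.congr hGg.symm).comp_quasiMeasurePreserving (hqmp x)
    · filter_upwards [hGx x, (hqmp x).ae hgC] with y hy hy'
      rw [norm_mul, hy]
      gcongr
    · refine Tendsto.const_mul _ (hgS.comp ?_)
      simpa [sub_eq_add_neg] using tendsto_atTop_add_const_right atTop (-y) tendsto_id
  rw [integral_mul_const] at hlim
  refine hlim.congr fun x => integral_congr_ae ?_
  filter_upwards [hGx x] with y hy
  rw [hy]

/-- The convolution of an integrable and a bounded function is uniformly
continuous. -/
lemma uniformContinuous_convolution {k F : ℝ → ℂ} {C : ℝ} (hk : Integrable k)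
    (hF : Measurable F) (hFC : ∀ x, ‖F x‖ ≤ C) :
    UniformContinuous fun x => ∫ y, k y * F (x - y) := by
  have hrep (x : ℝ) : ∫ y, k y * F (x - y) = ∫ y, k (x - y) * F y := by
    rw [← integral_sub_left_eq_self (fun y => k y * F (x - y)) volume x]
    simp
  have hint (x : ℝ) : Integrable fun y => k (x - y) * F y :=
    (hk.comp_sub_left x).mul_bdd hF.aestronglyMeasurable (Eventually.of_forall hFC)
  have hC : 0 ≤ C := (norm_nonneg _).trans (hFC 0)
  refine Metric.uniformContinuous_iff.2 fun ε hε => ?_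
  obtain ⟨δ, hδ, h⟩ := exists_integral_norm_sub_translate_lt hk (ε := ε / (C + 1)) (by positivity)
  refine ⟨δ, hδ, fun a b hab => ?_⟩
  have hsub : ∫ y, ‖k (a - y) - k (b - y)‖ = ∫ y, ‖k (y - (-a)) - k (y - (-b))‖ := by
    rw [← integral_neg_eq_self]
    simp [add_comm, sub_eq_add_neg]
  rw [dist_eq_norm, hrep a, hrep b, ← integral_sub (hint a) (hint b)]
  calc ‖∫ y, (k (a - y) * F y - k (b - y) * F y)‖
      ≤ ∫ y, ‖k (a - y) - k (b - y)‖ * C := by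
        refine norm_integral_le_of_norm_le
          (((hk.comp_sub_left a).sub (hk.comp_sub_left b)).norm.mul_const C)
          (Eventually.of_forall fun y => ?_)
        rw [← sub_mul, norm_mul]
        exact mul_le_mul_of_nonneg_left (hFC y) (norm_nonneg _)
    _ = (∫ y, ‖k (a - y) - k (b - y)‖) * C := integral_mul_const _ _
    _ ≤ ε / (C + 1) * C := by
        refine mul_le_mul_of_nonneg_right ?_ hC
        rw [hsub]
        refine (h (-b) (-a) ?_).le
        rw [neg_sub_neg]
        exact hab
    _ < ε := by
        rw [div_mul_eq_mul_div, div_lt_iff₀ (by positivity)]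
        nlinarith

/-- Wiener–Pitt Tauberian theorem on the line: if `F + k * F` tends essentially to `s` at `+∞` then
`F` tends essentially to `s / (1 + ∫ k)`. -/
lemma essentially_tendsto_of_add_convolution {k F : ℝ → ℂ} {s : ℂ} {C : ℝ} (hk : Integrable k)
    (hk' : ∀ c : ℂ, c.re = 0 → ∫ t : ℝ, k t * Complex.exp (c * t) ≠ -1)
    (hF : Measurable F) (hFC : ∀ x, ‖F x‖ ≤ C)
    (h : ∀ ε : ℝ, 0 < ε → ∃ R : ℝ, ∀ᵐ x : ℝ, R < x →
      ‖(F x + ∫ y, k y * F (x - y)) - s‖ < ε) :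
    ∀ ε : ℝ, 0 < ε → ∃ R : ℝ, ∀ᵐ x : ℝ, R < x → ‖F x - s / (1 + ∫ y, k y)‖ < ε := by
  set K : ℂ := ∫ y, k y
  have hK1 : 1 + K ≠ 0 := by
    have h1 := hk' 0 rfl
    simp only [zero_mul, Complex.exp_zero, mul_one] at h1
    rwa [ne_eq, add_comm, add_eq_zero_iff_eq_neg]
  set u : ℝ → ℂ := fun x => ∫ y, k y * F (x - y)
  have huc : UniformContinuous u := uniformContinuous_convolution hk hF hFC
  have hubdd (x : ℝ) : ‖u x‖ ≤ (∫ y, ‖k y‖) * C := by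
    rw [← integral_mul_const]
    refine norm_integral_le_of_norm_le (hk.norm.mul_const C) (Eventually.of_forall fun y => ?_)
    rw [norm_mul]
    exact mul_le_mul_of_nonneg_left (hFC _) (norm_nonneg _)
  set c : ℂ := K * s / (1 + K) with hc
  let v : ℝ →ᵇ ℂ := BoundedContinuousFunction.ofNormedAddCommGroup (fun x => u x - c)
    (huc.continuous.sub continuous_const) ((∫ y, ‖k y‖) * C + ‖c‖)
    fun x => (norm_sub_le _ _).trans (by gcongr; exact hubdd x)
  have hv : Tendsto v atTop (𝓝 0) := by
    refine tendsto_zero_of_tendsto_add_convolution hk hk'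
      (huc.sub (uniformContinuous_const (b := c))) ?_
    have hconv := tendsto_convolution_of_essentially_tendsto (g := fun x => F x + u x)
      (C := C + (∫ y, ‖k y‖) * C) hk
      (hF.aestronglyMeasurable.add huc.continuous.aestronglyMeasurable)
      (Eventually.of_forall fun x => norm_add_le_of_le (hFC x) (hubdd x)) h
    have hval : (K * s - c - K * c) = 0 := by
      rw [hc]; field_simp; ring
    rw [← hval]
    refine ((hconv.sub_const c).sub_const (K * c)).congr fun x => ?_
    have hi1 : Integrable fun y => k y * F (x - y) :=
      hk.mul_bdd (hF.comp (measurable_const.sub measurable_id)).aestronglyMeasurable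
        (Eventually.of_forall fun y => hFC _)
    have hi2 : Integrable fun y => k y * u (x - y) :=
      hk.mul_bdd (huc.continuous.comp (continuous_sub_left x)).aestronglyMeasurable
        (Eventually.of_forall fun y => hubdd _)
    change _ = (u x - c) + ∫ y, k y * (u (x - y) - c)
    simp_rw [mul_add, mul_sub]
    rw [integral_add hi1 hi2, integral_sub hi2 (hk.mul_const c), integral_mul_const]
    ring
  intro ε hε
  obtain ⟨R, hR⟩ := h (ε / 2) (half_pos hε)
  obtain ⟨R', hR'⟩ := eventually_atTop.1 (Metric.tendsto_nhds.1 hv (ε / 2) (half_pos hε))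
  refine ⟨max R R', ?_⟩
  filter_upwards [hR] with x hx hxR
  have h1 := hx ((le_max_left _ _).trans_lt hxR)
  have h2 : ‖u x - c‖ < ε / 2 := by
    simpa [v] using hR' x ((le_max_right _ _).trans hxR.le)
  have h3 : F x - s / (1 + K) = (F x + u x - s) - (u x - c) := by
    rw [hc]; field_simp; ring
  rw [h3]
  exact (norm_sub_le _ _).trans_lt (by linarith)

/-- The Paley–Wiener Tauberian theorem: if `k ∈ L¹(0,∞)`, its Laplace transform
avoids `−1` on the closed right half-plane, `f` is measurable and essentially
bounded, and `f(x) + ∫_0^x f(x−y)k(y)dy → s` as `x → +∞`, then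
`f(x) → s/(1 + ∫_0^∞ k)`. -/
theorem paley_wiener_tauberian (k f : ℝ → ℂ) (s : ℂ)
    (hk : IntegrableOn k (Set.Ici (0 : ℝ)))
    (hlap : ∀ z : ℂ, 0 ≤ z.re →
      (∫ x in Set.Ici (0 : ℝ), k x * Complex.exp (-z * (x : ℂ))) ≠ -1)
    (hf_meas : Measurable f)
    (hf_bdd : ∃ C : ℝ, ∀ᵐ x : ℝ, 0 ≤ x → ‖f x‖ ≤ C)
    (h0 : ∀ ε : ℝ, 0 < ε → ∃ R : ℝ, ∀ᵐ x : ℝ, R < x →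
      ‖(f x + ∫ y in Set.Icc (0 : ℝ) x, f (x - y) * k y) - s‖ < ε) :
    ∀ ε : ℝ, 0 < ε → ∃ R : ℝ, ∀ᵐ x : ℝ, R < x →
      ‖f x - s / (1 + ∫ y in Set.Ici (0 : ℝ), k y)‖ < ε := by
  obtain ⟨C, hC⟩ := hf_bdd
  let k₀ : ℝ → ℂ := (Set.Ici 0).indicator k
  have hk₀ : Integrable k₀ := hk.integrable_indicator measurableSet_Ici
  have hk₀' (c : ℂ) (hc : c.re = 0) : ∫ t : ℝ, k₀ t * Complex.exp (c * t) ≠ -1 := by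
    have h1 := hlap (-c) (by simp [hc])
    rw [neg_neg, ← integral_indicator measurableSet_Ici] at h1
    simpa only [k₀, Set.indicator_mul_left] using h1
  let S : Set ℝ := {x | 0 ≤ x ∧ ‖f x‖ ≤ C}
  have hS : MeasurableSet S :=
    measurableSet_Ici.inter (measurableSet_le hf_meas.norm measurable_const)
  let F : ℝ → ℂ := S.indicator f
  have hF : Measurable F := hf_meas.indicator hS
  have hFC (x : ℝ) : ‖F x‖ ≤ max C 0 := by
    by_cases hx : x ∈ S
    · simpa only [F, Set.indicator_of_mem hx] using le_max_of_le_left hx.2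
    · simp [F, Set.indicator_of_notMem hx]
  have hFf : ∀ᵐ x, 0 ≤ x → F x = f x := by
    filter_upwards [hC] with x hx hx0
    exact Set.indicator_of_mem (show x ∈ S from ⟨hx0, hx hx0⟩) f
  have hconv (x : ℝ) : ∫ y, k₀ y * F (x - y) = ∫ y in Set.Icc (0 : ℝ) x, f (x - y) * k y := by
    rw [← integral_indicator measurableSet_Icc]
    refine integral_congr_ae ?_
    filter_upwards [(Measure.measurePreserving_sub_left volume x).quasiMeasurePreserving.ae hFf] with y hy
    by_cases hy0 : 0 ≤ y
    · by_cases hyx : y ≤ x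
      · rw [Set.indicator_of_mem (show y ∈ Set.Icc 0 x from ⟨hy0, hyx⟩), hy (sub_nonneg.2 hyx),
          show k₀ y = k y from Set.indicator_of_mem hy0 k, mul_comm]
      · have hF0 : F (x - y) = 0 :=
          Set.indicator_of_notMem (fun hm => hyx (sub_nonneg.1 hm.1)) f
        rw [Set.indicator_of_notMem (fun hm => hyx hm.2), hF0, mul_zero]
    · rw [Set.indicator_of_notMem (fun hm => hy0 hm.1),
        show k₀ y = 0 from Set.indicator_of_notMem hy0 k, zero_mul]
  have hmain := essentially_tendsto_of_add_convolution (s := s) hk₀ hk₀' hF hFC fun ε hε => by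
    obtain ⟨R, hR⟩ := h0 ε hε
    refine ⟨max R 0, ?_⟩
    filter_upwards [hR, hFf] with x hx hx' hxR
    rw [hx' ((le_max_right _ _).trans hxR.le), hconv]
    exact hx ((le_max_left _ _).trans_lt hxR)
  intro ε hε
  obtain ⟨R, hR⟩ := hmain ε hε
  refine ⟨max R 0, ?_⟩
  filter_upwards [hR, hFf] with x hx hx' hxR
  rw [← hx' ((le_max_right _ _).trans hxR.le), ← integral_indicator measurableSet_Ici]
  exact hx ((le_max_left _ _).trans_lt hxR)
end

section
/- Let 0 < α < 1 and let (x_n)_{n≥1} be a sequence of complex numbers such that α·x_n + (1−α)·(1/n)·Σ_{k=1}^n x_k → x as n → ∞ for some x ∈ ℂ. Then x_n → x as n → ∞. -/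
/-- The partial sums of a complex sequence are controlled by its Mercer transform. -/
theorem mul_norm_sum_Icc_le_sum_norm_mercer {α : ℝ} (hα0 : 0 < α) (hα1 : α < 1) (y : ℕ → ℂ)
    (n : ℕ) :
    α * ‖∑ k ∈ Finset.Icc 1 n, y k‖ ≤ ∑ i ∈ Finset.range n,
      ‖(α : ℂ) * y (i + 1) + ((1 - α : ℝ) : ℂ) * (1 / ((i + 1 : ℕ) : ℂ)) *
        ∑ k ∈ Finset.Icc 1 (i + 1), y k‖ := by
  induction n with
  | zero => simp
  | succ n ih =>
    rw [Finset.sum_range_succ]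
    refine le_trans ?_ (add_le_add_left ih _)
    have hs := Finset.sum_Icc_succ_top (Nat.le_add_left 1 n) y
    set S := ∑ k ∈ Finset.Icc 1 n, y k
    set T := ∑ k ∈ Finset.Icc 1 (n + 1), y k
    set t := (α : ℂ) * y (n + 1) + ((1 - α : ℝ) : ℂ) * (1 / ((n + 1 : ℕ) : ℂ)) * T with ht
    have hc : 0 ≤ (1 - α) * (1 / ((n + 1 : ℕ) : ℝ)) :=
      mul_nonneg (by linarith) (by positivity)
    have key : ((α + (1 - α) * (1 / ((n + 1 : ℕ) : ℝ)) : ℝ) : ℂ) * T = (α : ℂ) * S + t := by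
      rw [ht, eq_sub_of_add_eq' hs.symm]
      push_cast
      ring
    calc α * ‖T‖ ≤ (α + (1 - α) * (1 / ((n + 1 : ℕ) : ℝ))) * ‖T‖ := by
          gcongr
          linarith
      _ = ‖(α : ℂ) * S + t‖ := by
          rw [← key, norm_mul, Complex.norm_of_nonneg (by linarith)]
      _ ≤ ‖(α : ℂ) * S‖ + ‖t‖ := norm_add_le _ _
      _ = α * ‖S‖ + ‖t‖ := by rw [norm_mul, Complex.norm_of_nonneg hα0.le]

/-- If the Mercer transform of a complex sequence tends to `0`, so do its Cesàro means. -/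
theorem tendsto_cesaro_zero_of_tendsto_mercer_zero {α : ℝ} (hα0 : 0 < α) (hα1 : α < 1)
    {y : ℕ → ℂ}
    (h : Filter.Tendsto
      (fun n : ℕ => (α : ℂ) * y n + ((1 - α : ℝ) : ℂ) * (1 / (n : ℂ)) * ∑ k ∈ Finset.Icc 1 n, y k)
      Filter.atTop (nhds 0)) :
    Filter.Tendsto (fun n : ℕ => (1 / (n : ℂ)) * ∑ k ∈ Finset.Icc 1 n, y k)
      Filter.atTop (nhds 0) := by
  have hces := (((Filter.tendsto_add_atTop_iff_nat 1).2 h).norm.cesaro).const_mul α⁻¹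
  rw [norm_zero, mul_zero] at hces
  refine squeeze_zero_norm (fun n => ?_) hces
  have hb := mul_norm_sum_Icc_le_sum_norm_mercer hα0 hα1 y n
  rw [norm_mul, norm_div, norm_one, Complex.norm_natCast, one_div, mul_left_comm]
  gcongr
  rwa [inv_mul_eq_div, le_div_iff₀' hα0]

/-- Mercer's theorem: if `0 < α < 1` and `α·xₙ + (1−α)·(1/n)·Σ_{k=1}^n x_k → x`,
then `xₙ → x`. -/
theorem mercer (α : ℝ) (hα0 : 0 < α) (hα1 : α < 1) (x : ℕ → ℂ) (L : ℂ)
    (h : Filter.Tendsto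
      (fun n : ℕ => (α : ℂ) * x n + ((1 - α : ℝ) : ℂ) * (1 / (n : ℂ)) * ∑ k ∈ Finset.Icc 1 n, x k)
      Filter.atTop (nhds L)) :
    Filter.Tendsto (fun n : ℕ => x n) Filter.atTop (nhds L) := by
  have hα : (α : ℂ) ≠ 0 := by exact_mod_cast hα0.ne'
  have hy : Filter.Tendsto
      (fun n : ℕ => (α : ℂ) * (x n - L) +
        ((1 - α : ℝ) : ℂ) * (1 / (n : ℂ)) * ∑ k ∈ Finset.Icc 1 n, (x k - L))
      Filter.atTop (nhds 0) := by
    rw [← sub_self L]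
    refine (h.sub_const L).congr' ?_
    filter_upwards [Filter.eventually_ne_atTop 0] with n hn
    have hn' : (n : ℂ) ≠ 0 := by exact_mod_cast hn
    rw [Finset.sum_sub_distrib, Finset.sum_const, Nat.card_Icc, Nat.add_sub_cancel, nsmul_eq_mul]
    push_cast
    field_simp
    ring
  have hm := tendsto_cesaro_zero_of_tendsto_mercer_zero hα0 hα1 hy
  have hx := ((hy.sub (hm.const_mul ((1 - α : ℝ) : ℂ))).const_mul (α : ℂ)⁻¹).add_const L
  rw [mul_zero, sub_zero, mul_zero, zero_add] at hx
  refine hx.congr fun n => ?_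
  rw [← mul_assoc, add_sub_cancel_right, inv_mul_cancel_left₀ hα, sub_add_cancel]
end
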